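/- arXiv:2201.13159 — 2 statements merged into one kernel-verified Lean document; each statement's English description precedes it below -/
import Mathlib

section
/- Let s ∈ (0,1), μ ∈ ℝ, P ∈ (0, ∞), and let φ be an even, P-periodic, nonconstant solution of the steady fKdV equation with wave speed μ which is nondecreasing on (−P/2, 0) and satisfies φ(x) ≤ μ for all x. Then φ is strictly increasing on (−P/2, 0): for all x, y ∈ (−P/2, 0) with x < y one has φ(x) < φ(y). -/
open MeasureTheory Set

/-- The Bessel kernel `K_s`. -/
noncomputable def besselKernel (s x : ℝ) : ℝ :=
  (1 / (2 * Real.sqrt Real.pi * Real.Gamma (s / 2))) *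
    ∫ t in Set.Ioi (0 : ℝ), Real.exp (-t - x ^ 2 / (4 * t)) * t ^ ((s - 3) / 2)

/-- A solution of the steady fKdV equation with wave speed `μ`: a bounded continuous
function satisfying the equation pointwise. -/
def IsFKdVSolution (s μ : ℝ) (φ : ℝ → ℝ) : Prop :=
  Continuous φ ∧ (∃ M, ∀ x, |φ x| ≤ M) ∧
    ∀ x, -μ * φ x + (φ x) ^ 2 / 2 + (∫ y, besselKernel s (x - y) * φ y) = 0

/-- The integrand. -/
noncomputable def bI (s x t : ℝ) : ℝ := Real.exp (-t - x ^ 2 / (4 * t)) * t ^ ((s - 3) / 2)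

theorem bI_meas (s : ℝ) : Measurable (fun p : ℝ × ℝ => bI s p.1 p.2) := by
  unfold bI
  fun_prop

theorem bI_meas' (s x : ℝ) : Measurable (fun t : ℝ => bI s x t) := by
  unfold bI
  fun_prop

theorem bI_pos (s x t : ℝ) (ht : 0 < t) : 0 < bI s x t := by
  unfold bI
  positivity

theorem bI_integrable (s x : ℝ) (hs : 0 < s) (hx : 0 < x) :
    IntegrableOn (fun t => bI s x t) (Ioi 0) := by
  have h := (Real.GammaIntegral_convergent (s := (s + 1) / 2) (by linarith)).const_mul (4 / x ^ 2)
  refine Integrable.mono' h (bI_meas' s x).aestronglyMeasurable ?_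
  refine (ae_restrict_mem measurableSet_Ioi).mono fun t ht => ?_
  have ht : 0 < t := ht
  rw [Real.norm_of_nonneg (bI_pos s x t ht).le]
  unfold bI
  have e1 : Real.exp (-t - x ^ 2 / (4 * t)) = Real.exp (-t) * (Real.exp (x ^ 2 / (4 * t)))⁻¹ := by
    rw [← Real.exp_neg, ← Real.exp_add]; congr 1
  have e2 : (Real.exp (x ^ 2 / (4 * t)))⁻¹ ≤ (x ^ 2 / (4 * t))⁻¹ := by
    apply inv_anti₀ (by positivity)
    have := Real.add_one_le_exp (x ^ 2 / (4 * t))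
    linarith
  have e3 : t ^ ((s + 1) / 2 - 1) = t * t ^ ((s - 3) / 2) := by
    rw [show (s + 1) / 2 - 1 = 1 + (s - 3) / 2 by ring, Real.rpow_add ht, Real.rpow_one]
  rw [e1, e3]
  calc Real.exp (-t) * (Real.exp (x ^ 2 / (4 * t)))⁻¹ * t ^ ((s - 3) / 2)
      ≤ Real.exp (-t) * (x ^ 2 / (4 * t))⁻¹ * t ^ ((s - 3) / 2) := by gcongr
    _ = _ := by field_simp

theorem besselKernel_eq_bI (s x : ℝ) : besselKernel s x =
    (1 / (2 * Real.sqrt Real.pi * Real.Gamma (s / 2))) * ∫ t in Ioi (0 : ℝ), bI s x t := rfl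

theorem besselKernel_neg (s x : ℝ) : besselKernel s (-x) = besselKernel s x := by
  simp [besselKernel]

theorem besselKernel_integrable (s : ℝ) (hs : 0 < s) : Integrable (besselKernel s) := by
  have key : Integrable (fun p : ℝ × ℝ => bI s p.1 p.2) (volume.prod (volume.restrict (Ioi 0))) := by
    have gi : ∀ t : ℝ, 0 < t → ∀ x, bI s x t =
        (Real.exp (-t) * t ^ ((s - 3) / 2)) * Real.exp (-(1 / (4 * t)) * x ^ 2) := by
      intro t ht x
      unfold bI
      rw [show -t - x ^ 2 / (4 * t) = -t + -(1 / (4 * t)) * x ^ 2 by ring, Real.exp_add]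
      ring
    rw [integrable_prod_iff' (bI_meas s).aestronglyMeasurable]
    constructor
    · refine (ae_restrict_mem measurableSet_Ioi).mono fun t ht => ?_
      have ht : 0 < t := ht
      simp only [gi t ht]
      exact (integrable_exp_neg_mul_sq (by positivity)).const_mul _
    · have h := (Real.GammaIntegral_convergent (s := s / 2) (by linarith)).const_mul
        (Real.sqrt (4 * Real.pi))
      refine h.congr ?_
      refine (ae_restrict_mem measurableSet_Ioi).mono fun t ht => ?_
      have ht : 0 < t := ht
      have e : ∀ x, ‖bI s x t‖ = (Real.exp (-t) * t ^ ((s - 3) / 2)) *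
          Real.exp (-(1 / (4 * t)) * x ^ 2) := fun x => by
        rw [Real.norm_of_nonneg (bI_pos s x t ht).le, gi t ht]
      simp only [e]
      rw [integral_const_mul, integral_gaussian]
      rw [show Real.pi / (1 / (4 * t)) = (4 * Real.pi) * t by field_simp,
        Real.sqrt_mul (by positivity : (0:ℝ) ≤ 4 * Real.pi) t, Real.sqrt_eq_rpow t,
        show s / 2 - 1 = (s - 3) / 2 + 1 / 2 by ring, Real.rpow_add ht]
      ring
  exact key.integral_prod_left.const_mul _

theorem bI_scale (s x u : ℝ) (hx : 0 < x) (hu : 0 < u) :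
    x * bI s x (x * u) = Real.exp ((s - 1) / 2 * Real.log x - (u + 1 / (4 * u)) * x) *
      u ^ ((s - 3) / 2) := by
  unfold bI
  have e1 : (x * u) ^ ((s - 3) / 2) = x ^ ((s - 3) / 2) * u ^ ((s - 3) / 2) :=
    Real.mul_rpow hx.le hu.le
  have e2 : x * x ^ ((s - 3) / 2) = Real.exp ((s - 1) / 2 * Real.log x) := by
    rw [mul_comm ((s - 1) / 2), ← Real.rpow_def_of_pos hx,
      show (s - 1) / 2 = 1 + (s - 3) / 2 by ring, Real.rpow_add hx, Real.rpow_one]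
  have e3 : -(x * u) - x ^ 2 / (4 * (x * u)) = - ((u + 1 / (4 * u)) * x) := by
    field_simp
    ring
  rw [e1, e3, sub_eq_add_neg ((s - 1) / 2 * Real.log x), Real.exp_add, ← e2]
  ring

theorem scaled_convex (s a x y α β : ℝ) (hs : s < 1) (hx : 0 < x) (hy : 0 < y) (hxy : x ≠ y)
    (hα : 0 < α) (hβ : 0 < β) (hab : α + β = 1) :
    Real.exp ((s - 1) / 2 * Real.log (α * x + β * y) - a * (α * x + β * y)) <
      α * Real.exp ((s - 1) / 2 * Real.log x - a * x) +
      β * Real.exp ((s - 1) / 2 * Real.log y - a * y) := by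
  have h1 := strictConcaveOn_log_Ioi.2 (show x ∈ Ioi (0:ℝ) from hx) (show y ∈ Ioi (0:ℝ) from hy)
    hxy hα hβ hab
  have h2 := convexOn_exp.2 (mem_univ ((s - 1) / 2 * Real.log x - a * x))
    (mem_univ ((s - 1) / 2 * Real.log y - a * y)) hα.le hβ.le hab
  simp only [smul_eq_mul] at h1 h2
  refine lt_of_lt_of_le (Real.exp_lt_exp.2 ?_) h2
  nlinarith

theorem besselKernel_strictConvex (s : ℝ) (hs : s ∈ Ioo (0 : ℝ) 1) :
    StrictConvexOn ℝ (Ioi 0) (besselKernel s) := by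
  obtain ⟨hs0, hs1⟩ := hs
  let G : ℝ → ℝ → ℝ := fun x u => x * bI s x (x * u)
  have hK : ∀ x, 0 < x → besselKernel s x =
      (1 / (2 * Real.sqrt Real.pi * Real.Gamma (s / 2))) * ∫ u in Ioi (0 : ℝ), G x u := by
    intro x hx
    rw [besselKernel_eq_bI]
    have := integral_comp_mul_left_Ioi (fun t => bI s x t) 0 hx
    simp only [mul_zero, smul_eq_mul] at this
    simp only [G]
    rw [integral_const_mul, this]
    field_simp
  have hG : ∀ x, 0 < x → IntegrableOn (G x) (Ioi 0) := by
    intro x hx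
    have := (integrableOn_Ioi_comp_mul_left_iff (fun t => bI s x t) 0 hx).2
      (by simpa using bI_integrable s x hs0 hx)
    exact this.const_mul x
  refine ⟨convex_Ioi 0, ?_⟩
  intro x hx y hy hxy α β hα hβ hab
  have hx : 0 < x := hx
  have hy : 0 < y := hy
  have hm : 0 < α * x + β * y := by positivity
  simp only [smul_eq_mul]
  rw [hK x hx, hK y hy, hK _ hm]
  have hC : 0 < (1 / (2 * Real.sqrt Real.pi * Real.Gamma (s / 2))) := by
    have := Real.Gamma_pos_of_pos (half_pos hs0)
    positivity
  have hlt : ∀ u, 0 < u → G (α * x + β * y) u < α * G x u + β * G y u := by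
    intro u hu
    simp only [G]
    rw [bI_scale s x u hx hu, bI_scale s y u hy hu, bI_scale s _ u hm hu]
    have := scaled_convex s (u + 1 / (4 * u)) x y α β hs1 hx hy hxy hα hβ hab
    have h3 : 0 < u ^ ((s - 3) / 2) := by positivity
    nlinarith [mul_lt_mul_of_pos_right this h3]
  have hint : 0 < ∫ u in Ioi (0 : ℝ), (α * G x u + β * G y u - G (α * x + β * y) u) := by
    have hi : IntegrableOn (fun u => α * G x u + β * G y u - G (α * x + β * y) u) (Ioi 0) :=
      (((hG x hx).const_mul α).add ((hG y hy).const_mul β)).sub (hG _ hm)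
    rw [setIntegral_pos_iff_support_of_nonneg_ae _ hi]
    · refine lt_of_lt_of_le (?_ : 0 < volume (Ioi (0:ℝ))) (measure_mono ?_)
      · simp
      · intro u hu
        exact ⟨(sub_pos.2 (hlt u hu)).ne', hu⟩
    · exact (ae_restrict_mem measurableSet_Ioi).mono fun u hu => (sub_pos.2 (hlt u hu)).le
  have hadd : IntegrableOn (fun u => α * G x u + β * G y u) (Ioi 0) :=
    ((hG x hx).const_mul α).add ((hG y hy).const_mul β)
  rw [integral_sub hadd (hG _ hm),
    integral_add ((hG x hx).const_mul α) ((hG y hy).const_mul β),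
    integral_const_mul α (G x), integral_const_mul β (G y)] at hint
  nlinarith [mul_pos hC hint]

theorem kernel_pair (K : ℝ → ℝ) (hK : StrictConvexOn ℝ (Ioi 0) K) (p q δ : ℝ) (hp : 0 < p)
    (hδ : 0 < δ) (hδq : δ < q - p) : K (p + δ) + K (q - δ) < K p + K q := by
  have hq : 0 < q - p := hδ.trans hδq
  have a1 : 0 < δ / (q - p) := div_pos hδ hq
  have a2 : 0 < 1 - δ / (q - p) := by rw [sub_pos, div_lt_one hq]; exact hδq
  have h1 := hK.2 (show p ∈ Ioi (0:ℝ) from hp) (show q ∈ Ioi (0:ℝ) from by simp; linarith)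
    (by linarith : p < q).ne a2 a1 (by ring)
  have h2 := hK.2 (show p ∈ Ioi (0:ℝ) from hp) (show q ∈ Ioi (0:ℝ) from by simp; linarith)
    (by linarith : p < q).ne a1 a2 (by ring)
  simp only [smul_eq_mul] at h1 h2
  have e : δ / (q - p) * (q - p) = δ := div_mul_cancel₀ _ hq.ne'
  rw [show (1 - δ / (q - p)) * p + δ / (q - p) * q = p + δ by linear_combination e] at h1
  rw [show (δ / (q - p)) * p + (1 - δ / (q - p)) * q = q - δ by linear_combination -e] at h2
  linarith

theorem reflect_integral (h : ℝ → ℝ) (α β : ℝ) (hab : α ≤ β) (hi : IntervalIntegrable h volume α β)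
    (hn : ∀ w ∈ Ioo α β, 0 ≤ h w + h (α + β - w)) :
    0 ≤ ∫ w in α..β, h w ∧ ((∫ w in α..β, h w = 0) →
      ∀ᵐ w ∂(volume.restrict (Ioo α β)), h w + h (α + β - w) = 0) := by
  have hi' : IntervalIntegrable (fun w => h (α + β - w)) volume α β := by
    have := (hi.comp_sub_left (α + β)).symm
    simpa using this
  have e1 : ∫ w in α..β, h (α + β - w) = ∫ w in α..β, h w := by
    rw [intervalIntegral.integral_comp_sub_left (fun w => h w) (α + β)]
    simp
  have e2 : ∫ w in α..β, (h w + h (α + β - w)) = 2 * ∫ w in α..β, h w := by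
    rw [intervalIntegral.integral_add hi hi', e1]; ring
  have hsum := hi.add hi'
  have hio : IntegrableOn (fun w => h w + h (α + β - w)) (Ioo α β) :=
    ((intervalIntegrable_iff_integrableOn_Ioo_of_le hab).1 hsum)
  rw [intervalIntegral.integral_of_le hab, integral_Ioc_eq_integral_Ioo] at e2
  have hnn : 0 ≤ᵐ[volume.restrict (Ioo α β)] (fun w => h w + h (α + β - w)) :=
    (ae_restrict_mem measurableSet_Ioo).mono hn
  constructor
  · have := integral_nonneg_of_ae hnn
    linarith
  · intro h0
    rw [h0, mul_zero] at e2
    exact (integral_eq_zero_iff_of_nonneg_ae hnn hio).1 e2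

theorem fold_lemma (g f : ℝ → ℝ) (a P : ℝ) (ha : 0 < a) (haP : 2 * a < P)
    (hg : ∀ u v, 0 < u → u < v → u + v < P → g v < g u) (hgs : ∀ w, g (P - w) = g w)
    (hodd : ∀ z, f (-z) = - f z) (hper : Function.Periodic f P)
    (hf : ∀ z ∈ Ioo (-(P / 2)) 0, 0 ≤ f z) (hc : Continuous f)
    (hi : IntervalIntegrable (fun w => g w * f (w - a)) volume 0 P) :
    0 ≤ ∫ w in (0)..P, g w * f (w - a) ∧
      ((∫ w in (0)..P, g w * f (w - a) = 0) → ∀ z, f z = 0) := by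
  have f0 : f 0 = 0 := by have := hodd 0; simp at this; linarith
  have hf' : ∀ z, 0 ≤ z → z < P / 2 → f z ≤ 0 := by
    intro z hz hz'
    rcases hz.eq_or_lt with h | h
    · rw [← h, f0]
    · have := hf (-z) ⟨by linarith, by linarith⟩
      rw [hodd] at this; linarith
  have hfP : ∀ z, f (P - z) = - f z := by
    intro z; rw [← hodd, ← hper (-z)]; ring_nf
  have hi1 : IntervalIntegrable (fun w => g w * f (w - a)) volume 0 (2 * a) :=
    hi.mono_set (by rw [uIcc_of_le (by linarith), uIcc_of_le (by linarith)]
                    exact Icc_subset_Icc le_rfl haP.le)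
  have hi2 : IntervalIntegrable (fun w => g w * f (w - a)) volume (2 * a) P :=
    hi.mono_set (by rw [uIcc_of_le (by linarith), uIcc_of_le (by linarith)]
                    exact Icc_subset_Icc (by linarith) le_rfl)
  have g2 : ∀ w w', w < P → w' < w → P < w + w' → g w' < g w := by
    intro w w' h1 h2 h3
    have := hg (P - w) w' (by linarith) (by linarith) (by linarith)
    rwa [hgs] at this
  have r1 : ∀ w, g w * f (w - a) + g (0 + 2 * a - w) * f (0 + 2 * a - w - a) =
      (g w - g (2 * a - w)) * f (w - a) := by
    intro w
    rw [show 0 + 2 * a - w - a = -(w - a) by ring, hodd, show 0 + 2 * a - w = 2 * a - w by ring]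
    ring
  have r2 : ∀ w, g w * f (w - a) + g (2 * a + P - w) * f (2 * a + P - w - a) =
      (g w - g (2 * a + P - w)) * f (w - a) := by
    intro w
    rw [show 2 * a + P - w - a = P -(w - a) by ring, hfP]
    ring
  have A1 := reflect_integral _ 0 (2 * a) (by linarith) hi1 (by
    intro w hw
    rw [r1]
    rcases lt_trichotomy w a with h | h | h
    · have := hg w (2 * a - w) hw.1 (by linarith) (by linarith)
      exact mul_nonneg (by linarith) (hf _ ⟨by linarith [hw.1], by linarith⟩)
    · simp [h, f0]
    · have := hg (2 * a - w) w (by linarith [hw.2]) (by linarith) (by linarith)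
      exact mul_nonneg_of_nonpos_of_nonpos (by linarith)
        (hf' _ (by linarith) (by linarith [hw.2])))
  have A2 := reflect_integral _ (2 * a) P haP.le hi2 (by
    intro w hw
    obtain ⟨hw1, hw2⟩ := hw
    rw [r2]
    rcases lt_trichotomy w (a + P / 2) with h | h | h
    · have := g2 (2 * a + P - w) w (by linarith) (by linarith) (by linarith)
      exact mul_nonneg_of_nonpos_of_nonpos (by linarith)
        (hf' _ (by linarith) (by linarith))
    · rw [show 2 * a + P - w = w by linarith]; simp
    · have := g2 w (2 * a + P - w) (by linarith) (by linarith) (by linarith)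
      refine mul_nonneg (by linarith) ?_
      have h5 := hper (w - a - P)
      rw [sub_add_cancel] at h5
      rw [h5]
      exact hf _ ⟨by linarith, by linarith⟩)
  have hsplit := intervalIntegral.integral_add_adjacent_intervals hi1 hi2
  refine ⟨by rw [← hsplit]; exact add_nonneg A1.1 A2.1, fun h0 => ?_⟩
  have B1 := A1.2 (by linarith [A1.1, A2.1])
  have B2 := A2.2 (by linarith [A1.1, A2.1])
  have hca : Continuous (fun w => f (w - a)) := by fun_prop
  have C1 : EqOn (fun w => f (w - a)) (fun _ => 0) (Ioo 0 (2 * a)) := by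
    refine Measure.eqOn_open_of_ae_eq (μ := volume) ?_ isOpen_Ioo hca.continuousOn
      continuousOn_const
    filter_upwards [B1, ae_restrict_mem measurableSet_Ioo] with w hw hm
    rw [r1] at hw
    rcases mul_eq_zero.1 hw with h | h
    · rcases lt_trichotomy w a with h' | h' | h'
      · have := hg w (2 * a - w) hm.1 (by linarith) (by linarith)
        linarith
      · simp [h', f0]
      · have := hg (2 * a - w) w (by linarith [hm.2]) (by linarith) (by linarith)
        linarith
    · exact h
  have fP2 : f (P / 2) = 0 := by
    have := hfP (P / 2)
    rw [show P - P / 2 = P / 2 by ring] at this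
    linarith
  have C2 : EqOn (fun w => f (w - a)) (fun _ => 0) (Ioo (2 * a) P) := by
    refine Measure.eqOn_open_of_ae_eq (μ := volume) ?_ isOpen_Ioo hca.continuousOn
      continuousOn_const
    filter_upwards [B2, ae_restrict_mem measurableSet_Ioo] with w hw hm
    obtain ⟨hm1, hm2⟩ := hm
    rw [r2] at hw
    rcases mul_eq_zero.1 hw with h | h
    · rcases lt_trichotomy w (a + P / 2) with h' | h' | h'
      · have := g2 (2 * a + P - w) w (by linarith) (by linarith) (by linarith)
        linarith
      · simp [h', fP2]
      · have := g2 w (2 * a + P - w) (by linarith) (by linarith) (by linarith)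
        linarith
    · exact h
  have D1 := C1.closure hca continuous_const
  have D2 := C2.closure hca continuous_const
  rw [closure_Ioo (by linarith)] at D1 D2
  intro z
  obtain ⟨y, hy, hzy⟩ := hper.exists_mem_Ico (by linarith) z (-a)
  rw [hzy]
  rcases le_total y a with h | h
  · have := D1 (show y + a ∈ Icc 0 (2 * a) from ⟨by linarith [hy.1], by linarith⟩)
    simpa using this
  · have := D2 (show y + a ∈ Icc (2 * a) P from ⟨by linarith, by linarith [hy.2]⟩)
    simpa using this

theorem hasSum_fold (L : ℝ → ℝ) (P : ℝ) (hP : 0 < P) (hL : Integrable L) :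
    HasSum (fun n : ℕ => ∫ w in (0)..P, (L (w + n * P) + L (w - (n + 1) * P))) (∫ w, L w) := by
  have h := hasSum_integral_iUnion (μ := volume) (f := L)
    (s := fun n : ℤ => Ioc (n • P) ((n + 1) • P)) (fun _ => measurableSet_Ioc)
    (pairwise_disjoint_Ioc_zsmul P) hL.integrableOn
  rw [iUnion_Ioc_zsmul hP, setIntegral_univ] at h
  have e : ∀ n : ℤ, ∫ w in Ioc (n • P) ((n + 1) • P), L w = ∫ w in (0)..P, L (w + n * P) := by
    intro n
    rw [intervalIntegral.integral_comp_add_right (fun w => L w),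
      intervalIntegral.integral_of_le (by linarith)]
    simp only [zsmul_eq_mul]
    push_cast
    ring_nf
  simp only [e] at h
  have h2 := h.nat_add_neg_add_one
  refine h2.congr_fun fun n => ?_
  rw [intervalIntegral.integral_add]
  · congr 1
    push_cast
    simp only [neg_mul, ← sub_eq_add_neg]
  · exact (hL.comp_add_right _).intervalIntegrable
  · exact (hL.comp_sub_right _).intervalIntegrable

theorem monotone_closed (φ : ℝ → ℝ) (a b : ℝ) (hab : a < b) (hc : Continuous φ)
    (hm : MonotoneOn φ (Ioo a b)) : MonotoneOn φ (Icc a b) := by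
  intro u hu v hv huv
  have hT : ∀ w, Filter.Tendsto (fun ε : ℝ => φ ((1 - ε) * w + ε * ((a + b) / 2)))
      (nhdsWithin 0 (Ioi 0)) (nhds (φ w)) := by
    intro w
    have h1 : Continuous (fun ε : ℝ => φ ((1 - ε) * w + ε * ((a + b) / 2))) := by fun_prop
    have h2 := h1.tendsto 0
    simp only [sub_zero, one_mul, zero_mul, add_zero] at h2
    exact h2.mono_left nhdsWithin_le_nhds
  refine le_of_tendsto_of_tendsto (hT u) (hT v) ?_
  have hmem : Ioo (0 : ℝ) 1 ∈ nhdsWithin (0 : ℝ) (Ioi 0) := Ioo_mem_nhdsGT one_pos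
  filter_upwards [hmem] with ε hε
  obtain ⟨h0, h1⟩ := hε
  have key : ∀ w ∈ Icc a b, (1 - ε) * w + ε * ((a + b) / 2) ∈ Ioo a b := by
    rintro w ⟨hw1, hw2⟩
    constructor <;> nlinarith [mul_pos h0 (sub_pos.2 hab)]
  exact hm (key u hu) (key v hv) (by nlinarith)

/-- Monotone fKdV traveling waves bounded by the wave speed are strictly increasing on
the half period. -/
theorem fKdV_strictMono (s μ P : ℝ) (hs : s ∈ Set.Ioo (0 : ℝ) 1) (hP : 0 < P)
    (φ : ℝ → ℝ) (hφ : IsFKdVSolution s μ φ) (heven : ∀ x, φ (-x) = φ x)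
    (hper : Function.Periodic φ P) (hnc : ∃ x y, φ x ≠ φ y)
    (hmono : MonotoneOn φ (Set.Ioo (-(P / 2)) 0)) (hle : ∀ x, φ x ≤ μ) :
    StrictMonoOn φ (Set.Ioo (-(P / 2)) 0) := by
  obtain ⟨hc, ⟨M, hM⟩, heq⟩ := hφ
  have hm := monotone_closed φ _ _ (by linarith) hc hmono
  intro x hx y hy hxy
  refine lt_of_le_of_ne (hmono hx hy hxy.le) fun hφxy => ?_
  have hconv : ∀ x, ∫ z, besselKernel s (x - z) * φ z = ∫ w, besselKernel s w * φ (x + w) := by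
    intro x
    rw [← integral_add_left_eq_self _ x]
    congr 1
    ext w
    rw [show x - (x + w) = -w by ring, besselKernel_neg]
  have hKi := besselKernel_integrable s hs.1
  have hKφ : ∀ x, Integrable (fun w => besselKernel s w * φ (x + w)) := by
    intro x
    refine hKi.mul_bdd (c := M) ?_ ?_
    · exact (by fun_prop : Continuous fun w => φ (x + w)).aestronglyMeasurable
    · exact Filter.Eventually.of_forall fun w => hM _
  obtain ⟨hx1, hx2⟩ := hx
  obtain ⟨hy1, hy2⟩ := hy
  let a : ℝ := -(x + y) / 2
  let h : ℝ := (y - x) / 2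
  have hadef : a = -(x + y) / 2 := rfl
  have hhdef : h = (y - x) / 2 := rfl
  let f : ℝ → ℝ := fun z => φ (z + h) - φ (z - h)
  have hfdef : ∀ w, f (w - a) = φ (y + w) - φ (x + w) := by
    intro w
    simp only [f]
    congr 2 <;> rw [hadef, hhdef] <;> ring
  have hI0 : ∫ w, besselKernel s w * f (w - a) = 0 := by
    have h1 := heq x
    have h2 := heq y
    rw [hconv] at h1 h2
    rw [← hφxy] at h2
    simp only [hfdef, mul_sub]
    rw [integral_sub (hKφ y) (hKφ x)]
    linarith
  have hLi : Integrable (fun w => besselKernel s w * f (w - a)) := by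
    simp only [hfdef, mul_sub]
    exact (hKφ y).sub (hKφ x)
  have hfodd : ∀ z, f (-z) = - f z := by
    intro z
    simp only [f]
    rw [← heven (-z + h), ← heven (-z - h)]
    ring_nf
  have hfper : Function.Periodic f P := by
    intro z
    simp only [f]
    rw [show z + P + h = z + h + P by ring, show z + P - h = z - h + P by ring, hper, hper]
  have hfc : Continuous f := by simp only [f]; fun_prop
  have hfn : ∀ z ∈ Ioo (-(P / 2)) 0, 0 ≤ f z := by
    rintro z ⟨hz1, hz2⟩
    simp only [f, sub_nonneg]
    obtain ⟨p, hp1, hp2, hp3, hp4⟩ : ∃ p, φ (z + h) = φ p ∧ p ≤ 0 ∧ z - h ≤ p ∧ -P - z + h ≤ p := by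
      rcases le_total (z + h) 0 with h' | h'
      · exact ⟨z + h, rfl, h', by linarith, by linarith⟩
      · exact ⟨-(z + h), (heven _).symm, by linarith, by linarith, by linarith⟩
    rw [hp1]
    rcases le_total (-(P / 2)) (z - h) with h' | h'
    · exact hm ⟨h', by linarith⟩ ⟨by linarith, hp2⟩ hp3
    · have : φ (z - h) = φ (-P - z + h) := by
        rw [← hper (z - h), ← heven]; ring_nf
      rw [this]
      exact hm ⟨by linarith, by linarith⟩ ⟨by linarith, hp2⟩ hp4
  let g : ℕ → ℝ → ℝ := fun n w => besselKernel s (n * P + w) + besselKernel s ((n + 1) * P - w)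
  have hsum := hasSum_fold _ P hP hLi
  rw [hI0] at hsum
  have hterm : ∀ (n : ℕ) (w : ℝ), besselKernel s (w + n * P) * f (w + n * P - a) +
      besselKernel s (w - (n + 1) * P) * f (w - (n + 1) * P - a) = g n w * f (w - a) := by
    intro n w
    have e1 : f (w + n * P - a) = f (w - a) := by
      rw [← hfper.nat_mul n (w - a)]; ring_nf
    have e2 : f (w - (n + 1) * P - a) = f (w - a) := by
      rw [← hfper.nat_mul (n + 1) (w - (n + 1) * P - a)]; push_cast; ring_nf
    have e3 : besselKernel s (w - (n + 1) * P) = besselKernel s ((n + 1) * P - w) := by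
      rw [← besselKernel_neg]; ring_nf
    simp only [g]
    rw [e1, e2, e3, add_comm w]; ring
  have hfold : ∀ n : ℕ, 0 ≤ ∫ w in (0)..P, g n w * f (w - a) ∧
      ((∫ w in (0)..P, g n w * f (w - a) = 0) → ∀ z, f z = 0) := by
    intro n
    refine fold_lemma (g n) f a P (by linarith) (by linarith) ?_ ?_ hfodd hfper hfn hfc ?_
    · intro u v hu huv huvP
      have := kernel_pair _ (besselKernel_strictConvex s hs) (n * P + u) ((n + 1) * P - u) (v - u)
        (by positivity) (by linarith) (by linarith)
      simp only [g]
      convert this using 3 <;> ring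
    · intro w
      simp only [g]
      rw [add_comm]
      congr 2 <;> ring
    · simp only [← hterm]
      exact ((hLi.comp_add_right (n * P)).add (hLi.comp_sub_right ((n + 1) * P))).intervalIntegrable
  simp only [hterm] at hsum
  have hall := (hasSum_zero_iff_of_nonneg (fun n => (hfold n).1)).1 hsum
  have hfz := (hfold 0).2 (congrFun hall 0)
  have hperh : Function.Periodic φ (2 * h) := by
    intro z
    have := hfz (z + h)
    simp only [f] at this
    rw [add_sub_cancel_right, sub_eq_zero] at this
    rw [← this]; ring_nf
  have hconst : ∀ z, φ z = φ (-(P / 2)) := by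
    intro z
    obtain ⟨r, hr, hzr⟩ := hperh.exists_mem_Ico (by linarith) z (-(P / 2))
    rw [hzr]
    have hr1 := hr.1
    have hr2 := hr.2
    have m1 := hm (show -(P / 2) ∈ Icc (-(P / 2)) 0 from ⟨le_rfl, by linarith⟩)
      (show r ∈ Icc (-(P / 2)) 0 from ⟨hr1, by linarith⟩) hr1
    have m2 := hm (show r ∈ Icc (-(P / 2)) 0 from ⟨hr1, by linarith⟩)
      (show -(P / 2) + 2 * h ∈ Icc (-(P / 2)) 0 from ⟨by linarith, by linarith⟩) hr2.le
    rw [hperh] at m2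
    exact le_antisymm m2 m1
  obtain ⟨p, q, hpq⟩ := hnc
  exact hpq (by rw [hconst p, hconst q])
end

section
/- Let s ∈ (0,1), μ ∈ ℝ, and let φ be a solution of the steady fKdV equation with wave speed μ such that φ(x) ≤ μ for all x ∈ ℝ. Then for every open set U ⊆ ℝ on which φ(x) < μ for all x ∈ U, the function φ is infinitely differentiable on U. -/
open MeasureTheory Set

/-- Unnormalised kernel. -/
noncomputable def GK (p x : ℝ) : ℝ :=
  ∫ t in Set.Ioi (0 : ℝ), Real.exp (-t - x ^ 2 / (4 * t)) * t ^ p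

lemma int_aux (p δ : ℝ) (hδ : 0 < δ) :
    IntegrableOn (fun t : ℝ => Real.exp (-t / 2 - δ / t) * t ^ p) (Ioi 0) := by
  obtain ⟨n, hn⟩ := exists_nat_gt (-p)
  have h1 : IntegrableOn (fun t : ℝ => t ^ (p + n) * Real.exp (-(1/2) * t ^ (1:ℝ))) (Ioi 0) :=
    integrableOn_rpow_mul_exp_neg_mul_rpow (by linarith) (by norm_num) (by norm_num)
  refine Integrable.mono' (h1.const_mul (n.factorial / δ ^ n)) ?_ ?_
  · apply Measurable.aestronglyMeasurable
    fun_prop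
  · refine (ae_restrict_iff' measurableSet_Ioi).2 (Filter.Eventually.of_forall ?_)
    intro t ht
    have ht : 0 < t := ht
    rw [Real.norm_of_nonneg (by positivity)]
    have h2 := Real.pow_div_factorial_le_exp (δ / t) (by positivity) n
    have h3 : Real.exp (-(δ / t)) ≤ n.factorial / δ ^ n * t ^ n := by
      rw [Real.exp_neg, inv_le_comm₀ (Real.exp_pos _) (by positivity)]
      refine le_trans (le_of_eq ?_) h2
      rw [div_pow]
      field_simp
    have h4 : t ^ (p + n) = t ^ p * t ^ n := by
      rw [Real.rpow_add ht, Real.rpow_natCast]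
    have h5 : Real.exp (-t / 2 - δ / t) = Real.exp (-(1/2) * t ^ (1:ℝ)) * Real.exp (-(δ / t)) := by
      rw [← Real.exp_add, Real.rpow_one]; congr 1; ring
    rw [h5, h4]
    calc _ ≤ Real.exp (-(1/2) * t ^ (1:ℝ)) * (n.factorial / δ ^ n * t ^ n) * t ^ p := by gcongr
      _ = _ := by ring

lemma exp_aux {r x t : ℝ} (hr : 0 < r) (hx : r ≤ |x|) (ht : 0 < t) :
    Real.exp (-t - x ^ 2 / (4 * t)) ≤
      Real.exp (-|x| / 2) * Real.exp (-t / 2 - (r ^ 2 / 8) / t) := by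
  rw [← Real.exp_add]
  apply Real.exp_le_exp.2
  have h1 : r ^ 2 ≤ x ^ 2 := by
    rw [← sq_abs x]; gcongr
  have h2 : r ^ 2 / 8 / t ≤ x ^ 2 / 8 / t := by gcongr
  have h3 : |x| / 2 ≤ t / 2 + x ^ 2 / 8 / t := by
    have : t / 2 + x ^ 2 / 8 / t - |x| / 2 = (|x| - 2 * t) ^ 2 / (8 * t) := by
      rw [sub_sq, sq_abs]; field_simp; ring
    have : 0 ≤ (|x| - 2 * t) ^ 2 / (8 * t) := by positivity
    linarith
  have h4 : x ^ 2 / (4 * t) = 2 * (x ^ 2 / 8 / t) := by field_simp; ring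
  rw [h4]; linarith

lemma GK_integrable (p x : ℝ) (hx : x ≠ 0) :
    IntegrableOn (fun t : ℝ => Real.exp (-t - x ^ 2 / (4 * t)) * t ^ p) (Ioi 0) := by
  have hx' : 0 < |x| := abs_pos.2 hx
  refine Integrable.mono' ((int_aux p (|x| ^ 2 / 8) (by positivity)).const_mul
    (Real.exp (-|x| / 2))) ?_ ?_
  · apply Measurable.aestronglyMeasurable
    fun_prop
  · refine (ae_restrict_iff' measurableSet_Ioi).2 (Filter.Eventually.of_forall ?_)
    intro t ht
    have ht : 0 < t := ht
    rw [Real.norm_of_nonneg (by positivity), ← mul_assoc]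
    gcongr
    exact exp_aux hx' le_rfl ht

lemma GK_nonneg (p x : ℝ) : 0 ≤ GK p x := by
  refine setIntegral_nonneg measurableSet_Ioi ?_
  intro t ht
  have ht : 0 < t := ht
  positivity

lemma GK_decay (p r : ℝ) (hr : 0 < r) :
    ∃ C, 0 ≤ C ∧ ∀ x, r ≤ |x| → |GK p x| ≤ C * Real.exp (-|x| / 2) := by
  refine ⟨∫ t in Ioi (0:ℝ), Real.exp (-t / 2 - (r ^ 2 / 8) / t) * t ^ p, ?_, ?_⟩
  · refine setIntegral_nonneg measurableSet_Ioi ?_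
    intro t ht
    have ht : 0 < t := ht
    positivity
  intro x hx
  rw [abs_of_nonneg (GK_nonneg p x), mul_comm, ← integral_const_mul]
  have hx0 : x ≠ 0 := by
    intro h; rw [h, abs_zero] at hx; linarith
  refine setIntegral_mono_on (GK_integrable p x hx0)
    ((int_aux p (r ^ 2 / 8) (by positivity)).const_mul _) measurableSet_Ioi ?_
  intro t ht
  have ht : 0 < t := ht
  rw [← mul_assoc]
  gcongr
  exact exp_aux hr hx ht

lemma GK_hasDerivAt (p x : ℝ) (hx : x ≠ 0) :
    HasDerivAt (GK p) (-(x / 2) * GK (p - 1) x) x := by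
  have hx' : 0 < |x| := abs_pos.2 hx
  have key := hasDerivAt_integral_of_dominated_loc_of_deriv_le (μ := volume.restrict (Ioi (0:ℝ)))
    (F := fun x t : ℝ => Real.exp (-t - x ^ 2 / (4 * t)) * t ^ p)
    (F' := fun x t : ℝ => Real.exp (-t - x ^ 2 / (4 * t)) * (-(2 * x / (4 * t))) * t ^ p)
    (x₀ := x) (s := Metric.ball x (|x| / 2))
    (bound := fun t : ℝ => |x| * (Real.exp (-t / 2 - ((|x| / 2) ^ 2 / 8) / t) * t ^ (p - 1)))
    (Metric.ball_mem_nhds x (by positivity)) ?_ (GK_integrable p x hx) ?_ ?_ ?_ ?_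
  · have h := key.2
    have e : (∫ t in Ioi (0:ℝ), Real.exp (-t - x ^ 2 / (4 * t)) * (-(2 * x / (4 * t))) * t ^ p)
        = -(x / 2) * GK (p - 1) x := by
      rw [GK, ← integral_const_mul]
      refine setIntegral_congr_fun measurableSet_Ioi ?_
      intro t ht
      have ht : 0 < t := ht
      simp only
      rw [Real.rpow_sub ht, Real.rpow_one]
      field_simp
      ring
    rw [e] at h
    exact h
  · refine Filter.Eventually.of_forall fun y => ?_
    apply Measurable.aestronglyMeasurable
    fun_prop
  · apply Measurable.aestronglyMeasurable
    fun_prop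
  · refine (ae_restrict_iff' measurableSet_Ioi).2 (Filter.Eventually.of_forall ?_)
    intro t ht y hy
    have ht : 0 < t := ht
    rw [Metric.mem_ball, Real.dist_eq] at hy
    have h1 : |x| / 2 ≤ |y| := by
      have := abs_sub_abs_le_abs_sub x y
      rw [abs_sub_comm] at this; linarith
    have h2 : |y| ≤ 2 * |x| := by
      have := abs_sub_abs_le_abs_sub y x
      linarith
    have h3 := exp_aux (by positivity) h1 ht
    have h4 : Real.exp (-|y| / 2) ≤ 1 := by
      apply Real.exp_le_one_iff.2
      have := abs_nonneg y
      linarith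
    have h5 : Real.exp (-t - y ^ 2 / (4 * t)) ≤ Real.exp (-t / 2 - ((|x| / 2) ^ 2 / 8) / t) := by
      refine h3.trans ?_
      have := Real.exp_pos (-t / 2 - ((|x| / 2) ^ 2 / 8) / t)
      nlinarith
    have h6 : ‖Real.exp (-t - y ^ 2 / (4 * t)) * (-(2 * y / (4 * t))) * t ^ p‖ =
        Real.exp (-t - y ^ 2 / (4 * t)) * (|y| / 2 * t ^ (p - 1)) := by
      rw [Real.rpow_sub ht, Real.rpow_one, Real.norm_eq_abs, abs_mul, abs_mul, abs_neg, abs_div,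
        abs_mul, abs_mul, Real.abs_exp, abs_of_pos ht, abs_of_pos (Real.rpow_pos_of_pos ht p)]
      norm_num
      field_simp
      norm_num
    rw [h6]
    calc _ ≤ Real.exp (-t / 2 - ((|x| / 2) ^ 2 / 8) / t) * (|x| * t ^ (p - 1)) := by
          gcongr
          linarith
      _ = _ := by ring
  · exact (int_aux (p - 1) ((|x| / 2) ^ 2 / 8) (by positivity)).const_mul _
  · refine (ae_restrict_iff' measurableSet_Ioi).2 (Filter.Eventually.of_forall ?_)
    intro t ht y hy
    have ht : 0 < t := ht
    have h1 : HasDerivAt (fun y : ℝ => -t - y ^ 2 / (4 * t)) (-(2 * y / (4 * t))) y := by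
      have := ((hasDerivAt_pow 2 y).div_const (4 * t)).const_sub (-t)
      simpa using this
    exact h1.exp.mul_const _

lemma GK_integrable_all (p : ℝ) (hp : -3 / 2 < p) : Integrable (GK p) := by
  have hg : ∀ t : ℝ, 0 < t → ∀ x : ℝ, Real.exp (-t - x ^ 2 / (4 * t)) * t ^ p =
      (Real.exp (-t) * t ^ p) * Real.exp (-(1 / (4 * t)) * x ^ 2) := by
    intro t ht x
    rw [sub_eq_add_neg, Real.exp_add]
    have : -(x ^ 2 / (4 * t)) = -(1 / (4 * t)) * x ^ 2 := by ring
    rw [this]; ring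
  have h : Integrable (fun z : ℝ × ℝ => Real.exp (-z.2 - z.1 ^ 2 / (4 * z.2)) * z.2 ^ p)
      (volume.prod (volume.restrict (Ioi (0:ℝ)))) := by
    rw [integrable_prod_iff']
    · constructor
      · refine (ae_restrict_iff' measurableSet_Ioi).2 (Filter.Eventually.of_forall ?_)
        intro t ht
        have ht : 0 < t := ht
        simp only [hg t ht]
        exact (integrable_exp_neg_mul_sq (by positivity)).const_mul _
      · have h1 : IntegrableOn (fun t : ℝ => Real.sqrt (4 * Real.pi) *
            (Real.exp (-t) * t ^ ((p + 3/2) - 1))) (Ioi 0) :=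
          (Real.GammaIntegral_convergent (by linarith)).const_mul _
        refine IntegrableOn.congr_fun h1 ?_ measurableSet_Ioi
        intro t ht
        have ht : 0 < t := ht
        have : ∀ x : ℝ, ‖Real.exp (-t - x ^ 2 / (4 * t)) * t ^ p‖ =
          (Real.exp (-t) * t ^ p) * Real.exp (-(1 / (4 * t)) * x ^ 2) := by
          intro x
          rw [← hg t ht, Real.norm_of_nonneg (by positivity)]
        simp only [this]
        rw [integral_const_mul, integral_gaussian]
        have e : Real.pi / (1 / (4 * t)) = (4 * Real.pi) * t := by field_simp
        rw [e, Real.sqrt_mul (by positivity : (0:ℝ) ≤ 4 * Real.pi) t, Real.sqrt_eq_rpow t]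
        have : p + 3 / 2 - 1 = p + 1 / 2 := by ring
        rw [this, Real.rpow_add ht]
        ring
    · apply Measurable.aestronglyMeasurable
      fun_prop
  exact h.integral_prod_left

lemma GK_even (p x : ℝ) : GK p (-x) = GK p x := by
  simp [GK]

lemma GK_anti (p x y : ℝ) (hx : 0 < x) (hxy : x ≤ y) : GK p y ≤ GK p x := by
  refine setIntegral_mono_on (GK_integrable p y (by linarith)) (GK_integrable p x hx.ne')
    measurableSet_Ioi ?_
  intro t ht
  have ht : 0 < t := ht
  gcongr

lemma GK_continuousOn (p : ℝ) : ContinuousOn (GK p) {0}ᶜ := by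
  intro x hx
  exact (GK_hasDerivAt p x hx).continuousAt.continuousWithinAt

lemma GK_measurable (p : ℝ) : Measurable (GK p) := by
  have h : StronglyMeasurable
      (fun z : ℝ × ℝ => Real.exp (-z.2 - z.1 ^ 2 / (4 * z.2)) * z.2 ^ p) := by
    apply Measurable.stronglyMeasurable
    fun_prop
  exact (h.integral_prod_right' (ν := volume.restrict (Ioi (0:ℝ)))).measurable

lemma pow_exp_aux (j : ℕ) : ∃ C, 0 ≤ C ∧ ∀ z : ℝ, |z| ^ j * Real.exp (-|z| / 2) ≤
    C * Real.exp (-|z| / 4) := by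
  refine ⟨4 ^ j * j.factorial, by positivity, fun z => ?_⟩
  have h := Real.pow_div_factorial_le_exp (|z| / 4) (by positivity) j
  rw [div_le_iff₀ (by positivity), div_pow, div_le_iff₀ (by positivity)] at h
  have e : Real.exp (-|z| / 4) = Real.exp (|z| / 4) * Real.exp (-|z| / 2) := by
    rw [← Real.exp_add]; congr 1; ring
  rw [e]
  calc _ ≤ (Real.exp (|z| / 4) * j.factorial * 4 ^ j) * Real.exp (-|z| / 2) := by gcongr
    _ = _ := by ring

lemma GKj_decay (j : ℕ) (p r : ℝ) (hr : 0 < r) :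
    ∃ C, 0 ≤ C ∧ ∀ x, r ≤ |x| → |x ^ j * GK p x| ≤ C * Real.exp (-|x| / 4) := by
  obtain ⟨C, hC, h⟩ := GK_decay p r hr
  obtain ⟨D, hD, h'⟩ := pow_exp_aux j
  refine ⟨C * D, by positivity, fun x hx => ?_⟩
  rw [abs_mul, abs_pow]
  calc _ ≤ |x| ^ j * (C * Real.exp (-|x| / 2)) := by gcongr; exact h x hx
    _ = C * (|x| ^ j * Real.exp (-|x| / 2)) := by ring
    _ ≤ C * (D * Real.exp (-|x| / 4)) := mul_le_mul_of_nonneg_left (h' x) hC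
    _ = _ := by ring

lemma exp_abs_integrable (x0 : ℝ) : Integrable (fun y : ℝ => Real.exp (-|x0 - y| / 4)) := by
  have h : Integrable (fun y : ℝ => Real.exp (-|y| / 4)) := by
    refine Integrable.mono' (integrable_inv_one_add_sq.const_mul 33) ?_ ?_
    · apply Measurable.aestronglyMeasurable
      fun_prop
    · refine Filter.Eventually.of_forall fun y => ?_
      rw [Real.norm_of_nonneg (Real.exp_pos _).le, neg_div, Real.exp_neg, ← div_eq_mul_inv,
        le_div_iff₀ (by positivity), inv_mul_le_iff₀ (Real.exp_pos _)]
      have h := Real.pow_div_factorial_le_exp (|y| / 4) (by positivity) 2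
      have h1 := Real.one_le_exp (x := |y| / 4) (by positivity)
      rw [div_pow, sq_abs] at h
      norm_num [Nat.factorial] at h
      linarith
  exact h.comp_sub_left x0

/-- The family of far-field integrals. -/
noncomputable def HK (f : ℝ → ℝ) (j : ℕ) (p x : ℝ) : ℝ :=
  ∫ y, (x - y) ^ j * GK p (x - y) * f y

lemma HK_hasDerivAt (f : ℝ → ℝ) (hf : Measurable f) (M : ℝ) (hM : ∀ x, |f x| ≤ M)
    (x0 r : ℝ) (hr : 0 < r) (h0 : ∀ y ∈ Metric.ball x0 (2 * r), f y = 0)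
    (j : ℕ) (p x : ℝ) (hx : x ∈ Metric.ball x0 r) :
    HasDerivAt (HK f j p) (j * HK f (j - 1) p x - (1 / 2) * HK f (j + 1) (p - 1) x) x := by
  have hM0 : 0 ≤ M := (abs_nonneg _).trans (hM 0)
  have hmeas : ∀ j p x, Measurable (fun y => (x - y) ^ j * GK p (x - y) * f y) := by
    intro j p x
    have := GK_measurable p
    fun_prop
  have hfar : ∀ x ∈ Metric.ball x0 r, ∀ y, f y ≠ 0 → r ≤ |x - y| := by
    intro x hx y hy
    by_contra hc
    push Not at hc
    apply hy
    apply h0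
    rw [Metric.mem_ball, Real.dist_eq] at *
    rw [abs_lt] at *
    constructor <;> linarith [hx.1, hx.2, hc.1, hc.2]
  have hb : ∀ j p, ∃ C, 0 ≤ C ∧ ∀ x ∈ Metric.ball x0 r, ∀ y,
      ‖(x - y) ^ j * GK p (x - y) * f y‖ ≤ C * Real.exp (-|x0 - y| / 4) := by
    intro j p
    obtain ⟨C, hC, h⟩ := GKj_decay j p r hr
    refine ⟨C * Real.exp (r / 4) * M, by positivity, fun x hx y => ?_⟩
    by_cases hy : f y = 0
    · rw [hy, mul_zero, norm_zero]; positivity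
    have h1 := h _ (hfar x hx y hy)
    have h2 : Real.exp (-|x - y| / 4) ≤ Real.exp (r / 4) * Real.exp (-|x0 - y| / 4) := by
      rw [← Real.exp_add]
      apply Real.exp_le_exp.2
      rw [Metric.mem_ball, Real.dist_eq] at hx
      have := abs_sub_abs_le_abs_sub (x0 - y) (x - y)
      have e : |x0 - y - (x - y)| = |x - x0| := by rw [abs_sub_comm]; congr 1; ring
      rw [e] at this
      linarith
    rw [norm_mul, Real.norm_eq_abs, Real.norm_eq_abs]
    calc _ ≤ (C * (Real.exp (r / 4) * Real.exp (-|x0 - y| / 4))) * M := by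
          gcongr
          · exact h1.trans (by gcongr)
          · exact hM y
      _ = _ := by ring
  have hint : ∀ j p, ∀ x ∈ Metric.ball x0 r,
      Integrable (fun y => (x - y) ^ j * GK p (x - y) * f y) := by
    intro j p x hx
    obtain ⟨C, hC, h⟩ := hb j p
    exact Integrable.mono' ((exp_abs_integrable x0).const_mul C)
      (hmeas j p x).aestronglyMeasurable (Filter.Eventually.of_forall (h x hx))
  obtain ⟨C1, hC1, hb1⟩ := hb (j - 1) p
  obtain ⟨C2, hC2, hb2⟩ := hb (j + 1) (p - 1)
  have key := hasDerivAt_integral_of_dominated_loc_of_deriv_le (μ := volume)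
    (F := fun x y : ℝ => (x - y) ^ j * GK p (x - y) * f y)
    (F' := fun x y : ℝ => j * ((x - y) ^ (j - 1) * GK p (x - y) * f y) -
      (1 / 2) * ((x - y) ^ (j + 1) * GK (p - 1) (x - y) * f y))
    (x₀ := x) (s := Metric.ball x0 r)
    (bound := fun y : ℝ => (j * C1 + (1 / 2) * C2) * Real.exp (-|x0 - y| / 4))
    (Metric.isOpen_ball.mem_nhds hx) ?_ (hint j p x hx) ?_ ?_ ?_ ?_
  · have h := key.2
    rw [integral_sub ((hint _ _ x hx).const_mul _) ((hint _ _ x hx).const_mul _),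
      integral_const_mul, integral_const_mul] at h
    exact h
  · exact Filter.Eventually.of_forall fun x => (hmeas j p x).aestronglyMeasurable
  · have h1 := hmeas (j - 1) p x
    have h2 := hmeas (j + 1) (p - 1) x
    exact ((h1.const_mul _).sub (h2.const_mul _)).aestronglyMeasurable
  · refine Filter.Eventually.of_forall fun y z hz => ?_
    refine (norm_sub_le _ _).trans ?_
    rw [norm_mul, norm_mul (1 / 2 : ℝ), add_mul, mul_assoc (j:ℝ) C1, mul_assoc (1 / 2 : ℝ) C2]
    have e1 : ‖(j:ℝ)‖ = j := by simp
    have e2 : ‖(1/2:ℝ)‖ = 1/2 := by norm_num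
    rw [e1, e2]
    exact add_le_add (mul_le_mul_of_nonneg_left (hb1 z hz y) (Nat.cast_nonneg j))
      (mul_le_mul_of_nonneg_left (hb2 z hz y) (by norm_num))
  · exact (exp_abs_integrable x0).const_mul _
  · refine Filter.Eventually.of_forall fun y z hz => ?_
    by_cases hy : f y = 0
    · simp only [hy, mul_zero, sub_zero]
      exact hasDerivAt_const _ _
    have hne : z - y ≠ 0 := by
      intro h
      have := hfar z hz y hy
      rw [h, abs_zero] at this; linarith
    have hs : HasDerivAt (fun z : ℝ => z - y) 1 z := (hasDerivAt_id z).sub_const y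
    have h1 : HasDerivAt (fun z : ℝ => (z - y) ^ j) (j * (z - y) ^ (j - 1) * 1) z := hs.pow j
    have h2 : HasDerivAt (fun z => GK p (z - y)) (-((z - y) / 2) * GK (p - 1) (z - y)) z := by
      have := (GK_hasDerivAt p (z - y) hne).comp z hs
      rw [mul_one] at this
      exact this
    refine ((h1.mul h2).mul_const (f y)).congr_deriv ?_
    ring

lemma HK_contDiffOn (f : ℝ → ℝ) (hf : Measurable f) (M : ℝ) (hM : ∀ x, |f x| ≤ M)
    (x0 r : ℝ) (hr : 0 < r) (h0 : ∀ y ∈ Metric.ball x0 (2 * r), f y = 0) (n : ℕ) :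
    ∀ (j : ℕ) (p : ℝ), ContDiffOn ℝ n (HK f j p) (Metric.ball x0 r) := by
  have hd := HK_hasDerivAt f hf M hM x0 r hr h0
  induction n with
  | zero =>
    intro j p
    rw [Nat.cast_zero, contDiffOn_zero]
    intro x hx
    exact (hd j p x hx).continuousAt.continuousWithinAt
  | succ n ih =>
    intro j p
    rw [Nat.cast_succ, contDiffOn_succ_iff_deriv_of_isOpen Metric.isOpen_ball]
    refine ⟨fun x hx => (hd j p x hx).differentiableAt.differentiableWithinAt, by simp, ?_⟩
    refine ContDiffOn.congr (f := fun x => j * HK f (j - 1) p x - (1 / 2) * HK f (j + 1) (p - 1) x)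
      ?_ (fun x hx => (hd j p x hx).deriv)
    exact (contDiffOn_const.mul (ih _ _)).sub (contDiffOn_const.mul (ih _ _))

/-- Convolution with a kernel. -/
noncomputable def cv (k w : ℝ → ℝ) (x : ℝ) : ℝ := ∫ y, k (x - y) * w y

lemma cv_comm (k w : ℝ → ℝ) (x : ℝ) : cv k w x = ∫ y, k y * w (x - y) := by
  have := integral_sub_left_eq_self (fun y => k y * w (x - y)) volume x
  simpa [cv] using this

lemma cv_integrable {k w : ℝ → ℝ} (hk : Integrable k) (hw : Measurable w) {M : ℝ}
    (hM : ∀ x, |w x| ≤ M) (x : ℝ) : Integrable (fun y => k (x - y) * w y) := by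
  refine (hk.comp_sub_left x).mul_bdd (c := M) hw.aestronglyMeasurable ?_
  exact Filter.Eventually.of_forall hM

lemma cv_integrable' {k w : ℝ → ℝ} (hk : Integrable k) (hw : Measurable w) {M : ℝ}
    (hM : ∀ x, |w x| ≤ M) (x : ℝ) : Integrable (fun y => k y * w (x - y)) := by
  refine hk.mul_bdd (c := M) (hw.comp (by fun_prop)).aestronglyMeasurable ?_
  exact Filter.Eventually.of_forall fun y => hM _

lemma cv_bound {k w : ℝ → ℝ} (hk : Integrable k) {M : ℝ}
    (hM : ∀ x, |w x| ≤ M) (x : ℝ) : |cv k w x| ≤ M * ∫ y, |k y| := by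
  rw [cv_comm, ← integral_const_mul, ← Real.norm_eq_abs]
  refine norm_integral_le_of_norm_le (hk.abs.const_mul M) ?_
  refine Filter.Eventually.of_forall fun y => ?_
  rw [Real.norm_eq_abs, abs_mul, mul_comm]
  gcongr
  exact hM _

lemma cv_sub_kernel {k l w : ℝ → ℝ} (hk : Integrable k) (hl : Integrable l) (hw : Measurable w)
    {M : ℝ} (hM : ∀ x, |w x| ≤ M) (x : ℝ) :
    cv (fun y => k y - l y) w x = cv k w x - cv l w x := by
  unfold cv
  rw [← integral_sub (cv_integrable hk hw hM x) (cv_integrable hl hw hM x)]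
  congr 1; ext y; ring

lemma cv_add {k v w : ℝ → ℝ} (hk : Integrable k) (hv : Measurable v) (hw : Measurable w)
    {M N : ℝ} (hN : ∀ x, |v x| ≤ N) (hM : ∀ x, |w x| ≤ M) (x : ℝ) :
    cv k (fun y => v y + w y) x = cv k v x + cv k w x := by
  unfold cv
  rw [← integral_add (cv_integrable hk hv hN x) (cv_integrable hk hw hM x)]
  congr 1; ext y; ring

lemma cv_continuous {k w : ℝ → ℝ} (hk : Integrable k) (hw : Measurable w) {M : ℝ}
    (hM : ∀ x, |w x| ≤ M) : Continuous (cv k w) := by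
  have hM0 : 0 ≤ M := (abs_nonneg _).trans (hM 0)
  apply continuous_of_uniform_approx_of_continuous
  rw [Metric.uniformity_basis_dist_le.forall_iff]
  · intro ε hε
    obtain ⟨g, hgc, hge, hgcont, hgi⟩ :=
      hk.exists_hasCompactSupport_integral_sub_le (ε := ε / (M + 1)) (by positivity)
    refine ⟨cv g w, ?_, ?_⟩
    · have hl : LocallyIntegrable w := by
        have h1 : LocallyIntegrable (fun _ : ℝ => M) := locallyIntegrable_const M
        exact h1.mono hw.aestronglyMeasurable (Filter.Eventually.of_forall fun x =>
          (hM x).trans (le_abs_self M))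
      have := hgc.continuous_convolution_left (ContinuousLinearMap.mul ℝ ℝ) hgcont hl
      convert this using 1
      ext x
      rw [cv_comm]
      rfl
    · intro x
      show dist (cv k w x) (cv g w x) ≤ ε
      rw [Real.dist_eq, ← cv_sub_kernel hk hgi hw hM]
      refine (cv_bound (hk.sub hgi) hM x).trans ?_
      calc M * ∫ y, |k y - g y| ≤ M * (ε / (M + 1)) := by
            gcongr
            exact hge
        _ = ε * (M / (M + 1)) := by ring
        _ ≤ ε * 1 := by
            gcongr
            rw [div_le_one (by positivity)]; linarith
        _ = ε := mul_one _
  · intro s t hst h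
    obtain ⟨F, hF, h⟩ := h
    exact ⟨F, hF, fun y => hst (h y)⟩

lemma cv_hasDerivAt {k ψ : ℝ → ℝ} (hk : Integrable k) {C : NNReal} (hψ : LipschitzWith C ψ)
    {M : ℝ} (hM : ∀ x, |ψ x| ≤ M) (x : ℝ) :
    HasDerivAt (cv k ψ) (cv k (deriv ψ) x) x := by
  have e : cv k ψ = fun x => ∫ y, k y * ψ (x - y) := by ext x; exact cv_comm k ψ x
  rw [e, cv_comm]
  have hm : Measurable ψ := hψ.continuous.measurable
  refine (hasDerivAt_integral_of_dominated_loc_of_lip (s := univ) (bound := fun y => |k y| * C)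
    (F' := fun y => k y * deriv ψ (x - y)) Filter.univ_mem ?_ (cv_integrable' hk hm hM x)
    ?_ ?_ (hk.abs.mul_const _) ?_).2
  · exact Filter.Eventually.of_forall fun x => (cv_integrable' hk hm hM x).aestronglyMeasurable
  · exact hk.aestronglyMeasurable.mul
      ((measurable_deriv ψ).comp (by fun_prop : Measurable fun y => x - y)).aestronglyMeasurable
  · refine Filter.Eventually.of_forall fun y => ?_
    refine LipschitzOnWith.of_dist_le_mul fun a _ b _ => ?_
    rw [Real.dist_eq, ← mul_sub, abs_mul, Real.coe_nnabs, abs_mul, abs_abs, mul_assoc]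
    gcongr
    have := hψ.dist_le_mul (a - y) (b - y)
    rw [Real.dist_eq, dist_sub_right] at this
    rw [NNReal.abs_eq]
    exact this
  · have h1 := hψ.ae_differentiableAt_real
    have h2 : ∀ᵐ y : ℝ, DifferentiableAt ℝ ψ (x - y) :=
      (Measure.measurePreserving_sub_left volume x).quasiMeasurePreserving.ae h1
    filter_upwards [h2] with y hy
    have h3 : HasDerivAt (fun z => ψ (z - y)) (deriv ψ (x - y)) x := by
      have := hy.hasDerivAt.comp x ((hasDerivAt_id x).sub_const y)
      rw [mul_one] at this
      exact this
    exact h3.const_mul (k y)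

lemma setIntegral_Ioi_shift (f : ℝ → ℝ) (a b : ℝ) :
    ∫ u in Ioi a, f (u + b) = ∫ u in Ioi (a + b), f u := by
  have := (measurePreserving_add_right volume b).setIntegral_preimage_emb
    (measurableEmbedding_addRight b) f (Ioi (a + b))
  rw [← this]
  simp

/-- `L¹` modulus of continuity of an even unimodal function. -/
lemma L1_shift {f : ℝ → ℝ} (hf : Integrable f) (heven : ∀ x, f (-x) = f x) (hpos : ∀ x, 0 ≤ f x)
    (hanti : ∀ x y, 0 ≤ x → x ≤ y → f y ≤ f x) {h : ℝ} (hh : 0 < h) :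
    ∫ y, |f (y + h) - f y| ≤ 2 * h * f 0 := by
  have habs : ∀ x, f |x| = f x := by
    intro x
    rcases abs_choice x with h | h <;> rw [h]
    exact heven x
  have hanti' : ∀ x y, |x| ≤ |y| → f y ≤ f x := by
    intro x y hxy
    rw [← habs x, ← habs y]
    exact hanti _ _ (abs_nonneg x) hxy
  have e1 : ∫ y, |f (y + h) - f y| = ∫ u, |f (u + h / 2) - f (u - h / 2)| := by
    rw [← integral_sub_right_eq_self _ (h / 2)]
    congr 1; ext u; congr 3; ring
  have e2 : ∀ u, |f (u + h / 2) - f (u - h / 2)| = (fun u => f (u - h / 2) - f (u + h / 2)) |u| := by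
    have key : ∀ u, 0 ≤ u → |f (u + h / 2) - f (u - h / 2)| = f (u - h / 2) - f (u + h / 2) := by
      intro u hu
      rw [abs_sub_comm, abs_of_nonneg]
      rw [sub_nonneg]
      apply hanti'
      rw [abs_of_nonneg (by linarith : 0 ≤ u + h / 2), abs_le]
      constructor <;> linarith
    intro u
    simp only
    rcases le_total 0 u with hu | hu
    · rw [abs_of_nonneg hu, key u hu]
    · rw [abs_of_nonpos hu, ← key (-u) (by linarith), ← heven (u + h / 2), ← heven (u - h / 2),
        abs_sub_comm]
      congr 3 <;> ring
  rw [e1]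
  simp only [e2]
  rw [integral_comp_abs (f := fun u => f (u - h / 2) - f (u + h / 2))]
  rw [integral_sub ((hf.comp_sub_right _).integrableOn) ((hf.comp_add_right _).integrableOn),
    setIntegral_Ioi_shift]
  simp only [sub_eq_add_neg _ (h / 2)]
  rw [setIntegral_Ioi_shift, zero_add, zero_add,
    intervalIntegral.integral_Ioi_sub_Ioi hf.integrableOn (by linarith)]
  have := intervalIntegral.norm_integral_le_of_norm_le_const (a := -(h / 2)) (b := h / 2) (f := f)
    (C := f 0) (by
      intro x _
      rw [Real.norm_of_nonneg (hpos x)]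
      exact hanti' _ _ (by simp))
  have h2 := (le_abs_self _).trans this
  have e3 : |h / 2 - -(h / 2)| = h := by
    rw [abs_of_nonneg] <;> linarith
  rw [e3] at h2
  linarith

lemma near_small {k : ℝ → ℝ} (hk : Integrable k) {ε : ℝ} (hε : 0 < ε) :
    ∃ δ0 > 0, ∀ δ, 0 < δ → δ ≤ δ0 → ∫ y in Ioc (-δ) δ, k y ≤ ε := by
  have hii : ∀ a b, IntervalIntegrable k volume a b := fun a b => hk.intervalIntegrable
  have hc : Continuous (fun δ : ℝ => ∫ y in (0:ℝ)..δ, k y) :=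
    intervalIntegral.continuous_primitive hii 0
  have hc2 : Continuous (fun δ : ℝ => (∫ y in (0:ℝ)..δ, k y) - ∫ y in (0:ℝ)..(-δ), k y) :=
    hc.sub (hc.comp continuous_neg)
  have h0 : Filter.Tendsto (fun δ : ℝ => (∫ y in (0:ℝ)..δ, k y) - ∫ y in (0:ℝ)..(-δ), k y)
      (nhds 0) (nhds 0) := by
    have := hc2.tendsto 0
    simpa using this
  obtain ⟨d, hd, h⟩ := Metric.eventually_nhds_iff.1 (h0.eventually_lt_const hε)
  refine ⟨d / 2, by positivity, fun δ h1 h2 => ?_⟩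
  have := h (y := δ) (by rw [Real.dist_eq, sub_zero, abs_of_pos h1]; linarith)
  rw [intervalIntegral.integral_interval_sub_left (hii _ _) (hii _ _),
    intervalIntegral.integral_of_le (by linarith)] at this
  exact this.le

lemma incr_bound {k : ℝ → ℝ} (hk : Integrable k) (hkm : Measurable k)
    (heven : ∀ x, k (-x) = k x) (hpos : ∀ x, 0 ≤ k x)
    (hanti : ∀ x y, 0 < x → x ≤ y → k y ≤ k x) {w : ℝ → ℝ} (hw : Measurable w) {M : ℝ}
    (hM : ∀ x, |w x| ≤ M) {x h δ D : ℝ} (hh : 0 < h) (hδ : 0 < δ)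
    (hD : ∀ y ∈ Ioc (-δ) δ, |w (x - y + h) - w (x - y)| ≤ D) :
    |cv k w (x + h) - cv k w x| ≤ D * (∫ y in Ioc (-δ) δ, k y) + 2 * M * h * ((∫ y, k y) / δ) := by
  have hM0 : 0 ≤ M := (abs_nonneg _).trans (hM 0)
  have habs : ∀ x, k |x| = k x := by
    intro x
    rcases abs_choice x with h | h <;> rw [h]
    exact heven x
  set f : ℝ → ℝ := fun y => k (max |y| δ) with hf
  have hfm : Measurable f := by
    rw [hf]; fun_prop
  have hfle : ∀ y, y ≠ 0 → f y ≤ k y := by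
    intro y hy
    rw [← habs y]
    exact hanti _ _ (abs_pos.2 hy) (le_max_left _ _)
  have hne : ∀ᵐ y : ℝ, y ≠ 0 := by
    simp [ae_iff]
  have hfi : Integrable f := by
    refine hk.mono' hfm.aestronglyMeasurable ?_
    filter_upwards [hne] with y hy
    rw [Real.norm_of_nonneg (hpos _)]
    exact hfle y hy
  have hf0 : f 0 = k δ := by simp [hf, hδ.le]
  have hkδ : k δ ≤ (∫ y, k y) / δ := by
    rw [le_div_iff₀ hδ]
    have h1 : ∫ _y in Ioc 0 δ, k δ ≤ ∫ y in Ioc 0 δ, k y := by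
      refine setIntegral_mono_on (by simp) hk.integrableOn measurableSet_Ioc ?_
      intro y hy
      exact hanti _ _ hy.1 hy.2
    have h2 : ∫ y in Ioc 0 δ, k y ≤ ∫ y, k y :=
      setIntegral_le_integral hk (Filter.Eventually.of_forall hpos)
    have h3 : ∫ _y in Ioc 0 δ, k δ = k δ * δ := by
      simp [hδ.le, mul_comm]
    linarith
  have hfar : |cv f w (x + h) - cv f w x| ≤ 2 * M * h * ((∫ y, k y) / δ) := by
    have e : cv f w (x + h) - cv f w x = cv (fun z => f (z + h) - f z) w x := by
      rw [cv_sub_kernel (hfi.comp_add_right h) hfi hw hM]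
      congr 1
      unfold cv
      congr 1; ext y; congr 2; ring
    rw [e]
    refine (cv_bound ((hfi.comp_add_right h).sub hfi) hM x).trans ?_
    have h1 := L1_shift hfi (fun x => by simp [hf]) (fun x => hpos _) (fun x y hx hxy => by
      apply hanti
      · exact lt_max_of_lt_right hδ
      · rw [abs_of_nonneg hx, abs_of_nonneg (hx.trans hxy)]
        exact max_le_max hxy le_rfl) hh
    rw [hf0] at h1
    calc _ ≤ M * (2 * h * ((∫ y, k y) / δ)) := by
          gcongr
          exact h1.trans (by gcongr)
      _ = _ := by ring
  have hnear : |cv (fun y => k y - f y) w (x + h) - cv (fun y => k y - f y) w x| ≤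
      D * (∫ y in Ioc (-δ) δ, k y) := by
    have hni : Integrable (fun y => k y - f y) := hk.sub hfi
    rw [cv_comm, cv_comm, ← integral_sub (cv_integrable' hni hw hM _) (cv_integrable' hni hw hM _),
      ← integral_const_mul, ← integral_indicator measurableSet_Ioc, ← Real.norm_eq_abs]
    refine norm_integral_le_of_norm_le ((hk.const_mul D).indicator measurableSet_Ioc) ?_
    filter_upwards [hne] with y hy
    by_cases hyδ : y ∈ Ioc (-δ) δ
    · rw [indicator_of_mem hyδ, ← mul_sub, norm_mul, mul_comm, Real.norm_eq_abs, Real.norm_eq_abs]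
      have h1 : |k y - f y| ≤ k y := by
        rw [abs_of_nonneg (by linarith [hfle y hy])]
        have : 0 ≤ f y := hpos _
        linarith
      have h2 := hD y hyδ
      have e : x + h - y = x - y + h := by ring
      rw [e]
      have := hpos y
      gcongr
      exact (abs_nonneg _).trans h2
    · rw [indicator_of_notMem hyδ]
      have h1 : δ ≤ |y| := by
        by_contra hc
        push Not at hc
        rw [abs_lt] at hc
        exact hyδ ⟨hc.1, hc.2.le⟩
      have h2 : f y = k y := by
        simp only [hf]
        rw [max_eq_left h1, habs]
      simp [h2]
  rw [cv_sub_kernel hk hfi hw hM, cv_sub_kernel hk hfi hw hM] at hnear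
  calc _ = |((cv k w (x + h) - cv f w (x + h)) - (cv k w x - cv f w x)) +
        (cv f w (x + h) - cv f w x)| := by congr 1; ring
    _ ≤ _ := (abs_add_le _ _).trans (add_le_add hnear hfar)

/-- The absorption argument. -/
lemma lip_gain {k : ℝ → ℝ} (hk : Integrable k) (hkm : Measurable k)
    (heven : ∀ x, k (-x) = k x) (hpos : ∀ x, 0 ≤ k x)
    (hanti : ∀ x y, 0 < x → x ≤ y → k y ≤ k x) {w : ℝ → ℝ} (hw : Measurable w) {M : ℝ}
    (hM : ∀ x, |w x| ≤ M) {x0 R A B : ℝ} (hR : 0 < R) (hA : 0 ≤ A) (hB : 0 ≤ B)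
    (H : ∀ x h, |x - x0| < R → 0 < h → h < R →
      |w (x + h) - w x| ≤ A * (|cv k w (x + h) - cv k w x| + B * h)) :
    ∃ L, 0 ≤ L ∧ ∀ x h, |x - x0| < R → 0 < h → h < R →
      (R - |x - x0|) * |w (x + h) - w x| ≤ L * h := by
  have hM0 : 0 ≤ M := (abs_nonneg _).trans (hM 0)
  obtain ⟨δ0, hδ0, hε⟩ := near_small hk (ε := 1 / (4 * (A + 1))) (by positivity)
  set η := min (1 / 2) (δ0 / R) with hη
  have hη0 : 0 < η := lt_min (by norm_num) (by positivity)
  have hη1 : η ≤ 1 / 2 := min_le_left _ _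
  have hη2 : η * R ≤ δ0 := by
    rw [← le_div_iff₀ hR]; exact min_le_right _ _
  set I0 := ∫ y, k y with hI0
  have hI : 0 ≤ I0 := integral_nonneg hpos
  set C := A * (2 * M * I0 / η + B * R) with hC
  have hC0 : 0 ≤ C := by positivity
  refine ⟨2 * C, by positivity, fun x1 h hx1 hh hhR => ?_⟩
  set T := (fun x => (R - |x - x0|) * |w (x + h) - w x|) '' {x | |x - x0| < R} with hT
  have hbdd : BddAbove T := by
    refine ⟨R * (M + M), ?_⟩
    rintro _ ⟨x, hx, rfl⟩
    have hx : |x - x0| < R := hx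
    have h1 : |w (x + h) - w x| ≤ M + M := (abs_sub _ _).trans (add_le_add (hM _) (hM _))
    have := abs_nonneg (x - x0)
    simp only
    gcongr
    linarith
  set S := sSup T with hS
  have hle : ∀ x, |x - x0| < R → (R - |x - x0|) * |w (x + h) - w x| ≤ S :=
    fun x hx => le_csSup hbdd ⟨x, hx, rfl⟩
  have hS0 : 0 ≤ S := by
    refine le_trans ?_ (hle x1 hx1)
    exact mul_nonneg (by linarith) (abs_nonneg _)
  have hstep : ∀ x, |x - x0| < R → (R - |x - x0|) * |w (x + h) - w x| ≤ S / 2 + C * h := by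
    intro x hx
    set d := R - |x - x0| with hd
    have hd0 : 0 < d := by linarith
    have hdR : d ≤ R := by linarith [abs_nonneg (x - x0)]
    have hδ : 0 < η * d := by positivity
    have hδ' : η * d ≤ δ0 := le_trans (by gcongr) hη2
    have hinc := incr_bound hk hkm heven hpos hanti hw hM (x := x) (h := h) (δ := η * d)
      (D := 2 * S / d) hh hδ (by
        intro y hy
        have hy1 : |y| ≤ d / 2 := by
          rw [abs_le]
          have : η * d ≤ 1 / 2 * d := by gcongr
          constructor <;> linarith [hy.1, hy.2]
        have h1 : |x - y - x0| ≤ |x - x0| + |y| := by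
          have : x - y - x0 = (x - x0) - y := by ring
          rw [this]; exact abs_sub _ _
        have h2 := hle (x - y) (by linarith)
        rw [le_div_iff₀ hd0]
        have h3 : d / 2 ≤ R - |x - y - x0| := by linarith
        have h4 := mul_le_mul_of_nonneg_right h3 (abs_nonneg (w (x - y + h) - w (x - y)))
        linarith)
    have h5 := hε _ hδ hδ'
    have h6 := H x h hx hh hhR
    have h7 : |cv k w (x + h) - cv k w x| ≤ 2 * S / d * (1 / (4 * (A + 1))) +
        2 * M * h * (I0 / (η * d)) := by
      refine hinc.trans ?_
      gcongr
    calc d * |w (x + h) - w x| ≤ d * (A * ((2 * S / d * (1 / (4 * (A + 1))) +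
        2 * M * h * (I0 / (η * d))) + B * h)) := by
          gcongr
          exact h6.trans (by gcongr)
      _ = S / 2 * (A / (A + 1)) + A * (2 * M * I0 / η + B * d) * h := by
          field_simp
          ring
      _ ≤ S / 2 * 1 + A * (2 * M * I0 / η + B * R) * h := by
          gcongr
          rw [div_le_one (by positivity)]; linarith
      _ = _ := by rw [mul_one]
  have hfin : S ≤ S / 2 + C * h := by
    have hTne : T.Nonempty := ⟨_, mem_image_of_mem _ hx1⟩
    apply csSup_le hTne
    rintro _ ⟨x, hx, rfl⟩
    exact hstep x hx
  have := hle x1 hx1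
  linarith

lemma bk_eq (s : ℝ) : besselKernel s =
    fun x => (1 / (2 * Real.sqrt Real.pi * Real.Gamma (s / 2))) * GK ((s - 3) / 2) x := rfl

lemma bk_const_nonneg {s : ℝ} (hs : 0 < s) :
    0 ≤ 1 / (2 * Real.sqrt Real.pi * Real.Gamma (s / 2)) := by
  have := Real.Gamma_pos_of_pos (half_pos hs)
  positivity

lemma bk_integrable {s : ℝ} (hs : 0 < s) : Integrable (besselKernel s) := by
  rw [bk_eq]
  exact (GK_integrable_all _ (by linarith)).const_mul _

lemma bk_measurable (s : ℝ) : Measurable (besselKernel s) := by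
  rw [bk_eq]
  exact (GK_measurable _).const_mul _

lemma bk_far {s : ℝ} {f : ℝ → ℝ} (hf : Measurable f) {M : ℝ} (hM : ∀ x, |f x| ≤ M)
    {x0 r : ℝ} (hr : 0 < r) (h0 : ∀ y ∈ Metric.ball x0 (2 * r), f y = 0) (n : ℕ) :
    ContDiffOn ℝ n (cv (besselKernel s) f) (Metric.ball x0 r) := by
  have h := HK_contDiffOn f hf M hM x0 r hr h0 n 0 ((s - 3) / 2)
  have e : cv (besselKernel s) f =
      fun x => (1 / (2 * Real.sqrt Real.pi * Real.Gamma (s / 2))) * HK f 0 ((s - 3) / 2) x := by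
    ext x
    rw [cv, HK, bk_eq, ← integral_const_mul]
    congr 1; ext y
    simp only [pow_zero, one_mul]
    ring
  rw [e]
  exact contDiffOn_const.mul h

lemma cv_lip_contDiff {k ψ : ℝ → ℝ} (hk : Integrable k) {C : NNReal} (hψ : LipschitzWith C ψ)
    {M : ℝ} (hM : ∀ x, |ψ x| ≤ M) : ContDiff ℝ 1 (cv k ψ) := by
  have h := cv_hasDerivAt hk hψ hM
  rw [contDiff_one_iff_deriv]
  refine ⟨fun x => (h x).differentiableAt, ?_⟩
  have e : deriv (cv k ψ) = cv k (deriv ψ) := by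
    ext x; exact (h x).deriv
  rw [e]
  exact cv_continuous hk (measurable_deriv ψ) (M := C) (fun x => norm_deriv_le_of_lipschitz hψ)

lemma lip_to_C1 {s : ℝ} (hs : 0 < s) {w : ℝ → ℝ} (hw : Measurable w) {M : ℝ}
    (hM : ∀ x, |w x| ≤ M) {x0 r : ℝ} (hr : 0 < r) {C : NNReal}
    (hC : LipschitzOnWith C w (Icc (x0 - 2 * r) (x0 + 2 * r))) :
    ContDiffAt ℝ 1 (cv (besselKernel s) w) x0 := by
  set c : ℝ → ℝ := fun x => max (x0 - 2 * r) (min x (x0 + 2 * r)) with hc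
  have hcl : LipschitzWith 1 c := (LipschitzWith.id.min_const _).const_max _
  have hcm : ∀ x, c x ∈ Icc (x0 - 2 * r) (x0 + 2 * r) := by
    intro x
    refine ⟨le_max_left _ _, max_le (by linarith) (min_le_right _ _)⟩
  have hci : ∀ x ∈ Metric.ball x0 (2 * r), c x = x := by
    intro x hx
    rw [Metric.mem_ball, Real.dist_eq, abs_lt] at hx
    simp only [hc]
    rw [min_eq_left (by linarith [hx.2]), max_eq_right (by linarith [hx.1])]
  set v : ℝ → ℝ := fun x => w (c x) with hv
  have hvl : LipschitzWith C v := by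
    refine LipschitzWith.of_dist_le_mul fun x y => ?_
    refine (hC.dist_le_mul _ (hcm x) _ (hcm y)).trans ?_
    have := hcl.dist_le_mul x y
    rw [NNReal.coe_one, one_mul] at this
    gcongr
  have hvM : ∀ x, |v x| ≤ M := fun x => hM _
  have hvm : Measurable v := hvl.continuous.measurable
  have e : cv (besselKernel s) w = fun x => cv (besselKernel s) v x +
      cv (besselKernel s) (w - v) x := by
    ext x
    rw [← cv_add (bk_integrable hs) hvm (hw.sub hvm) hvM
      (fun x => (abs_sub _ _).trans (add_le_add (hM x) (hvM x)))]
    congr 1; ext y; simp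
  rw [e]
  refine (cv_lip_contDiff (bk_integrable hs) hvl hvM).contDiffAt.add ?_
  have := bk_far (s := s) (n := 1) (hw.sub hvm)
    (fun x => (abs_sub _ _).trans (add_le_add (hM x) (hvM x))) hr (x0 := x0) (by
      intro y hy
      simp only [Pi.sub_apply, hv, hci y hy, sub_self])
  exact_mod_cast this.contDiffAt (Metric.ball_mem_nhds x0 hr)

lemma C1_gain {s : ℝ} (hs : 0 < s) {w : ℝ → ℝ} (hw : Measurable w) {M : ℝ}
    (hM : ∀ x, |w x| ≤ M) {x0 A B : ℝ} (hA : 0 ≤ A) (hB : 0 ≤ B) {t : Set ℝ} (ht : t ∈ nhds x0)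
    (H : ∀ x ∈ t, ∀ y ∈ t, x < y → |w y - w x| ≤
      A * (|cv (besselKernel s) w y - cv (besselKernel s) w x| + B * (y - x))) :
    ContDiffAt ℝ 1 (cv (besselKernel s) w) x0 := by
  obtain ⟨R2, hR2, hsub⟩ := Metric.mem_nhds_iff.1 ht
  set R := R2 / 2 with hR
  have hR0 : 0 < R := by positivity
  have hc := bk_const_nonneg hs
  obtain ⟨L, hL, h⟩ := lip_gain (bk_integrable hs) (bk_measurable s)
    (fun x => by rw [bk_eq]; simp only [GK_even])
    (fun x => by rw [bk_eq]; exact mul_nonneg hc (GK_nonneg _ _))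
    (fun x y hx hxy => by
      rw [bk_eq]; exact mul_le_mul_of_nonneg_left (GK_anti _ _ _ hx hxy) hc)
    hw hM (x0 := x0) hR0 hA hB (by
      intro x h hx hh hhR
      have := H x (hsub (by rw [Metric.mem_ball, Real.dist_eq]; linarith)) (x + h) (hsub (by
        rw [Metric.mem_ball, Real.dist_eq]
        have e : x + h - x0 = (x - x0) + h := by ring
        have := abs_add_le (x - x0) h
        rw [e]; rw [abs_of_pos hh] at this; linarith)) (by linarith)
      rwa [add_sub_cancel_left] at this)
  have key : ∀ x ∈ Icc (x0 - 2 * (R / 6)) (x0 + 2 * (R / 6)),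
      ∀ y ∈ Icc (x0 - 2 * (R / 6)) (x0 + 2 * (R / 6)), x < y →
      |w y - w x| ≤ (2 * L / R) * (y - x) := by
    intro x hx y hy hxy
    have h1 : |x - x0| ≤ R / 3 := by
      rw [abs_le]; constructor <;> linarith [hx.1, hx.2]
    have h2 := h x (y - x) (by linarith) (by linarith) (by linarith [hx.1, hy.2])
    rw [add_sub_cancel] at h2
    have h3 : R / 2 ≤ R - |x - x0| := by linarith
    have h4 := mul_le_mul_of_nonneg_right h3 (abs_nonneg (w y - w x))
    rw [div_mul_eq_mul_div, le_div_iff₀ hR0]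
    linarith
  refine lip_to_C1 hs hw hM (r := R / 6) (by positivity) (C := Real.toNNReal (2 * L / R)) ?_
  refine LipschitzOnWith.of_dist_le_mul fun x hx y hy => ?_
  rw [Real.dist_eq, Real.dist_eq, Real.coe_toNNReal _ (by positivity)]
  rcases lt_trichotomy x y with hxy | hxy | hxy
  · rw [abs_sub_comm, abs_sub_comm x y, abs_of_pos (by linarith : 0 < y - x)]
    exact key x hx y hy hxy
  · simp [hxy]
  · rw [abs_of_pos (by linarith : 0 < x - y)]
    exact key y hy x hx hxy

lemma localize {s : ℝ} (hs : 0 < s) {w : ℝ → ℝ} (hw : Continuous w) {M : ℝ}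
    (hM : ∀ x, |w x| ≤ M) {V : Set ℝ} (hV : IsOpen V) (hwV : ContDiffOn ℝ 1 w V)
    {x0 : ℝ} (hx0 : x0 ∈ V) :
    ∃ r > 0, ∃ v ρ : ℝ → ℝ, Metric.ball x0 r ⊆ V ∧ Continuous v ∧ (∃ N, ∀ x, |v x| ≤ N) ∧
      (∀ n : ℕ, ContDiffOn ℝ n ρ (Metric.ball x0 r)) ∧
      (∀ x ∈ Metric.ball x0 r, HasDerivAt w (v x) x) ∧
      (∀ x ∈ Metric.ball x0 r, HasDerivAt (cv (besselKernel s) w)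
        (cv (besselKernel s) v x + ρ x) x) := by
  obtain ⟨R, hR, hsub⟩ := Metric.isOpen_iff.1 hV x0 hx0
  let χ : ContDiffBump x0 := ⟨R / 3, R / 2, by positivity, by linarith⟩
  set r := R / 6 with hr
  have hr0 : 0 < r := by positivity
  set ψ : ℝ → ℝ := fun x => χ x * w x with hψ
  have hψw : ∀ x ∈ Metric.ball x0 (2 * r), ψ x = w x := by
    intro x hx
    simp only [hψ]
    rw [χ.one_of_mem_closedBall, one_mul]
    refine Metric.ball_subset_closedBall (Metric.ball_subset_ball ?_ hx)
    show 2 * r ≤ R / 3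
    linarith
  have hψsupp : HasCompactSupport ψ := χ.hasCompactSupport.mul_right
  have hψC1 : ContDiff ℝ 1 ψ := by
    rw [contDiff_iff_contDiffAt]
    intro x
    by_cases hx : x ∈ Metric.ball x0 R
    · exact χ.contDiffAt.mul (hwV.contDiffAt (hV.mem_nhds (hsub hx)))
    · have : ψ =ᶠ[nhds x] fun _ => 0 := by
        have hopen : IsOpen (Metric.closedBall x0 (R / 2))ᶜ := Metric.isClosed_closedBall.isOpen_compl
        have hmem : x ∈ (Metric.closedBall x0 (R / 2))ᶜ := by
          intro hc
          apply hx
          exact Metric.closedBall_subset_ball (by linarith) hc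
        filter_upwards [hopen.mem_nhds hmem] with y hy
        simp only [hψ]
        rw [χ.zero_of_le_dist, zero_mul]
        show R / 2 ≤ dist y x0
        have hy : ¬ dist y x0 ≤ R / 2 := hy
        linarith
      exact contDiffAt_const.congr_of_eventuallyEq this
  obtain ⟨C, hC⟩ := ContDiff.lipschitzWith_of_hasCompactSupport hψsupp hψC1 (by simp)
  have hψM : ∀ x, |ψ x| ≤ M := by
    intro x
    simp only [hψ]
    rw [abs_mul, abs_of_nonneg χ.nonneg]
    have h1 := χ.le_one (x := x)
    have h2 := χ.nonneg (x := x)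
    have := hM x
    have := abs_nonneg (w x)
    nlinarith
  have hψm : Measurable ψ := hC.continuous.measurable
  have hdb : ∀ x, |w x - ψ x| ≤ M + M :=
    fun x => (abs_sub _ _).trans (add_le_add (hM x) (hψM x))
  have hfar := bk_far (s := s) (hw.measurable.sub hψm) hdb hr0 (x0 := x0) (by
      intro y hy
      simp only [Pi.sub_apply, hψw y hy, sub_self])
  have e : cv (besselKernel s) w = fun x => cv (besselKernel s) ψ x +
      cv (besselKernel s) (w - ψ) x := by
    ext x
    rw [← cv_add (bk_integrable hs) hψm (hw.measurable.sub hψm) hψM hdb]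
    congr 1; ext y; simp
  refine ⟨r, hr0, deriv ψ, deriv (cv (besselKernel s) (w - ψ)), ?_, ?_, ⟨C, ?_⟩, ?_, ?_, ?_⟩
  · exact (Metric.ball_subset_ball (by linarith)).trans hsub
  · exact hψC1.continuous_deriv le_rfl
  · exact fun x => norm_deriv_le_of_lipschitz hC
  · intro n
    have := hfar (n + 1)
    rw [Nat.cast_succ, contDiffOn_succ_iff_deriv_of_isOpen Metric.isOpen_ball] at this
    exact this.2.2
  · intro x hx
    have h1 : HasDerivAt ψ (deriv ψ x) x := (hψC1.differentiable (by simp) x).hasDerivAt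
    refine h1.congr_of_eventuallyEq ?_
    have hx2 : x ∈ Metric.ball x0 (2 * r) := Metric.ball_subset_ball (by linarith) hx
    filter_upwards [Metric.isOpen_ball.mem_nhds hx2] with y hy
    exact (hψw y hy).symm
  · intro x hx
    rw [e]
    refine (cv_hasDerivAt (bk_integrable hs) hC hψM x).add ?_
    have := (hfar 1).contDiffAt (Metric.isOpen_ball.mem_nhds hx)
    exact (this.differentiableAt (by simp)).hasDerivAt

lemma linear_reg {s : ℝ} (hs : 0 < s) (n : ℕ) : ∀ (V : Set ℝ) (w a b : ℝ → ℝ), IsOpen V →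
    Continuous w → (∃ M, ∀ x, |w x| ≤ M) → ContDiffOn ℝ n a V → ContDiffOn ℝ n b V →
    (∀ x ∈ V, 0 < a x) → (∀ x ∈ V, a x * w x = cv (besselKernel s) w x + b x) →
    ContDiffOn ℝ n w V := by
  induction n with
  | zero =>
    intro V w a b _ hw _ _ _ _ _
    rw [Nat.cast_zero, contDiffOn_zero]
    exact hw.continuousOn
  | succ n ih =>
    intro V w a b hV hw hM ha hb hapos heq
    have hle : ((n : ℕ) : WithTop ℕ∞) ≤ ((n + 1 : ℕ) : WithTop ℕ∞) := by
      exact_mod_cast Nat.le_succ n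
    have hle1 : (1 : WithTop ℕ∞) ≤ ((n + 1 : ℕ) : WithTop ℕ∞) := by
      exact_mod_cast Nat.le_add_left 1 n
    have hwn : ContDiffOn ℝ n w V := ih V w a b hV hw hM (ha.of_le hle) (hb.of_le hle) hapos heq
    obtain ⟨M, hM⟩ := hM
    have hM0 : 0 ≤ M := (abs_nonneg _).trans (hM 0)
    have hw1 : ContDiffOn ℝ 1 w V := by
      intro x0 hx0
      have hVn := hV.mem_nhds hx0
      have ha1 : ContDiffAt ℝ 1 a x0 := (ha.contDiffAt hVn).of_le hle1
      have hb1 : ContDiffAt ℝ 1 b x0 := (hb.contDiffAt hVn).of_le hle1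
      obtain ⟨Ka, ta, hta, hKa⟩ := ha1.exists_lipschitzOnWith
      obtain ⟨Kb, tb, htb, hKb⟩ := hb1.exists_lipschitzOnWith
      have hpos0 := hapos x0 hx0
      have htc : {x | a x0 / 2 < a x} ∈ nhds x0 :=
        ha1.continuousAt.eventually (lt_mem_nhds (by linarith))
      have hcv : ContDiffAt ℝ 1 (cv (besselKernel s) w) x0 := by
        refine C1_gain hs hw.measurable hM (A := 2 / a x0) (B := Kb + Ka * M) (by positivity)
          (by positivity) (Filter.inter_mem (Filter.inter_mem hVn htc) (Filter.inter_mem hta htb)) ?_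
        rintro x ⟨⟨hxV, hxc⟩, hxa, hxb⟩ y ⟨⟨hyV, hyc⟩, hya, hyb⟩ hxy
        have h1 := heq x hxV
        have h2 := heq y hyV
        have h3 := hKa.dist_le_mul y hya x hxa
        have h4 := hKb.dist_le_mul y hyb x hxb
        rw [Real.dist_eq, Real.dist_eq, abs_of_pos (sub_pos.2 hxy)] at h3 h4
        have hxc : a x0 / 2 < a x := hxc
        have e : a x * (w y - w x) = (cv (besselKernel s) w y - cv (besselKernel s) w x) +
            ((b y - b x) - (a y - a x) * w y) := by linarith
        have h5 : |(b y - b x) - (a y - a x) * w y| ≤ (Kb + Ka * M) * (y - x) := by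
          refine (abs_sub _ _).trans ?_
          rw [abs_mul, add_mul]
          refine add_le_add h4 ?_
          calc |a y - a x| * |w y| ≤ (Ka * (y - x)) * M := by
                gcongr
                exact hM y
            _ = _ := by ring
        have h6 : a x0 / 2 * |w y - w x| ≤ |cv (besselKernel s) w y - cv (besselKernel s) w x| +
            (Kb + Ka * M) * (y - x) := by
          calc a x0 / 2 * |w y - w x| ≤ a x * |w y - w x| := by gcongr
            _ = |a x * (w y - w x)| := by rw [abs_mul, abs_of_pos (hapos x hxV)]
            _ ≤ _ := by
              rw [e]
              exact (abs_add_le _ _).trans (by gcongr)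
        rw [div_mul_eq_mul_div, le_div_iff₀ hpos0]
        linarith
      refine ContDiffAt.contDiffWithinAt ?_
      refine ((hcv.add hb1).div ha1 hpos0.ne').congr_of_eventuallyEq ?_
      filter_upwards [hVn] with x hx
      have := hapos x hx
      rw [Pi.div_apply, ← heq x hx]
      field_simp
    intro x0 hx0
    obtain ⟨r, hr, v, ρ, hsub, hvc, hvb, hρ, hdw, hdcv⟩ := localize hs hw hM hV hw1 hx0
    have hvn : ContDiffOn ℝ n v (Metric.ball x0 r) := by
      have ha' := (ha.mono hsub)
      have hb' := (hb.mono hsub)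
      rw [Nat.cast_succ, contDiffOn_succ_iff_deriv_of_isOpen Metric.isOpen_ball] at ha' hb'
      refine ih _ v a (fun x => ρ x + deriv b x - deriv a x * w x) Metric.isOpen_ball hvc hvb
        ((ha.mono hsub).of_le hle) (((hρ n).add hb'.2.2).sub (ha'.2.2.mul (hwn.mono hsub)))
        (fun x hx => hapos x (hsub hx)) ?_
      intro x hx
      have hnb := Metric.isOpen_ball.mem_nhds hx
      have hda := (ha'.1.differentiableAt hnb).hasDerivAt
      have hdb := (hb'.1.differentiableAt hnb).hasDerivAt
      have h1 := hda.mul (hdw x hx)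
      have h2 := (hdcv x hx).add hdb
      have h3 : (a * w) =ᶠ[nhds x] (cv (besselKernel s) w + b) := by
        filter_upwards [hnb] with y hy
        exact heq y (hsub hy)
      have h4 := h1.unique (h2.congr_of_eventuallyEq h3)
      linarith
    have hwn1 : ContDiffOn ℝ ((n + 1 : ℕ) : WithTop ℕ∞) w (Metric.ball x0 r) := by
      rw [Nat.cast_succ, contDiffOn_succ_iff_deriv_of_isOpen Metric.isOpen_ball]
      refine ⟨fun x hx => (hdw x hx).differentiableAt.differentiableWithinAt, by simp, ?_⟩
      exact hvn.congr fun x hx => (hdw x hx).deriv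
    exact (hwn1.contDiffAt (Metric.ball_mem_nhds x0 hr)).contDiffWithinAt

/-- fKdV traveling waves are smooth wherever they are strictly below the wave speed. -/
theorem fKdV_smooth_below_crest (s μ : ℝ) (hs : s ∈ Set.Ioo (0 : ℝ) 1)
    (φ : ℝ → ℝ) (hφ : IsFKdVSolution s μ φ) (hle : ∀ x, φ x ≤ μ) :
    ∀ U : Set ℝ, IsOpen U → (∀ x ∈ U, φ x < μ) → ContDiffOn ℝ (⊤ : ℕ∞) φ U := by
  intro U hU hlt
  obtain ⟨hc, ⟨M, hM⟩, heq⟩ := hφ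
  have hs0 := hs.1
  have heq' : ∀ x, (μ - φ x) ^ 2 = μ ^ 2 - 2 * cv (besselKernel s) φ x := by
    intro x
    have := heq x
    unfold cv
    linarith
  have hC1 : ContDiffOn ℝ 1 φ U := by
    intro x0 hx0
    have h0 : 0 < μ - φ x0 := sub_pos.2 (hlt x0 hx0)
    have htc : {x | (μ - φ x0) / 2 < μ - φ x} ∈ nhds x0 :=
      (continuous_const.sub hc).continuousAt.eventually (lt_mem_nhds (by show _ < μ - φ x0; linarith))
    have hcv : ContDiffAt ℝ 1 (cv (besselKernel s) φ) x0 := by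
      refine C1_gain hs0 hc.measurable hM (A := 2 / (μ - φ x0)) (B := 0) (by positivity) le_rfl
        htc ?_
      intro x hx y hy hxy
      have hx : (μ - φ x0) / 2 < μ - φ x := hx
      have hy : (μ - φ x0) / 2 < μ - φ y := hy
      have e : (μ - φ x + (μ - φ y)) * (φ y - φ x) =
          2 * (cv (besselKernel s) φ y - cv (besselKernel s) φ x) := by
        have h1 := heq' x
        have h2 := heq' y
        linarith
      have e2 : (μ - φ x + (μ - φ y)) * |φ y - φ x| =
          2 * |cv (besselKernel s) φ y - cv (besselKernel s) φ x| := by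
        have := congrArg abs e
        rwa [abs_mul, abs_mul, abs_of_pos (by linarith), abs_of_pos (by norm_num : (0:ℝ) < 2)] at this
      have h3 : (μ - φ x0) * |φ y - φ x| ≤ (μ - φ x + (μ - φ y)) * |φ y - φ x| := by
        gcongr
        linarith
      rw [zero_mul, add_zero, div_mul_eq_mul_div, le_div_iff₀ h0]
      linarith
    refine ContDiffAt.contDiffWithinAt ?_
    have hpos : 0 < μ ^ 2 - 2 * cv (besselKernel s) φ x0 := by
      rw [← heq' x0]; positivity
    have hsq : ContDiffAt ℝ 1 (fun x => μ - Real.sqrt (μ ^ 2 - 2 * cv (besselKernel s) φ x)) x0 :=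
      contDiffAt_const.sub ((contDiffAt_const.sub (contDiffAt_const.mul hcv)).sqrt hpos.ne')
    refine hsq.congr_of_eventuallyEq (Filter.Eventually.of_forall fun x => ?_)
    simp only
    rw [← heq' x, Real.sqrt_sq (by linarith [hle x])]
    ring
  have hn : ∀ n : ℕ, ContDiffOn ℝ ((n + 1 : ℕ) : WithTop ℕ∞) φ U := by
    intro n
    induction n with
    | zero => exact_mod_cast hC1
    | succ n ih =>
      intro x0 hx0
      obtain ⟨r, hr, v, ρ, hsub, hvc, hvb, hρ, hdw, hdcv⟩ := localize hs0 hc hM hU hC1 hx0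
      have hvn : ContDiffOn ℝ ((n + 1 : ℕ) : WithTop ℕ∞) v (Metric.ball x0 r) := by
        refine linear_reg hs0 (n + 1) _ v (fun x => μ - φ x) ρ Metric.isOpen_ball hvc hvb
          (contDiffOn_const.sub (ih.mono hsub)) (hρ _)
          (fun x hx => sub_pos.2 (hlt x (hsub hx))) ?_
        intro x hx
        have h1 := ((hdw x hx).const_sub μ).pow 2
        have h2 := ((hdcv x hx).const_mul 2).const_sub (μ ^ 2)
        have h3 : (fun x => μ - φ x) ^ 2 =
            fun x => μ ^ 2 - 2 * cv (besselKernel s) φ x := by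
          ext y; exact heq' y
        rw [h3] at h1
        have h4 := h1.unique h2
        norm_num at h4
        linarith
      have hwn1 : ContDiffOn ℝ ((n + 1 + 1 : ℕ) : WithTop ℕ∞) φ (Metric.ball x0 r) := by
        rw [Nat.cast_succ, contDiffOn_succ_iff_deriv_of_isOpen Metric.isOpen_ball]
        refine ⟨fun x hx => (hdw x hx).differentiableAt.differentiableWithinAt, by simp, ?_⟩
        exact hvn.congr fun x hx => (hdw x hx).deriv
      exact (hwn1.contDiffAt (Metric.ball_mem_nhds x0 hr)).contDiffWithinAt
  rw [contDiffOn_infty]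
  intro n
  exact (hn n).of_le (by exact_mod_cast Nat.le_succ n)
end
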